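/- Assume d > p and that Q satisfies Q(u) ≥ (∫_Ω W|u|^{p*} dx)^{p/p*} for all u ∈ C_c^∞(Ω), where W is a positive continuous function on Ω and p* = pd/(d−p). Let Ṽ ∈ L^∞_loc(Ω) satisfy ∫_Ω |Ṽ|^{d/p}·W^{−d/p*} dx < ∞, and for λ ∈ ℝ set Q̃_λ(u) := Q(u) + λ∫_Ω Ṽ|u|^p dx. If Q̃_λ ≥ 0 on C_c^∞(Ω) and Q̃_λ admits a ground state v, then for every ψ ∈ C_c^∞(Ω) with ∫_Ω ψ v dx ≠ 0 there exist constants C, C₁ > 0 such that the Hardy–Sobolev–Maz'ya–Poincaré type inequality Q̃_λ(u) + C₁·|∫_Ω ψ u dx|^p ≥ C·(∫_Ω W|u|^{p*} dx)^{p/p*} holds for all u ∈ C_c^∞(Ω). -/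

import Mathlib

open MeasureTheory Real Topology Filter RealInnerProductSpace

noncomputable section

/-- A real-valued test function on `Ω`: smooth, compactly supported, support inside `Ω`. -/
def IsTestFun {d : ℕ} (Ω : Set (EuclideanSpace ℝ (Fin d)))
    (u : EuclideanSpace ℝ (Fin d) → ℝ) : Prop :=
  ContDiff ℝ (⊤ : ℕ∞) u ∧ HasCompactSupport u ∧ tsupport u ⊆ Ω

/-- `V ∈ L^∞_loc(Ω)`: `V` is locally bounded on `Ω`. -/
def LocBddOn {d : ℕ} (Ω : Set (EuclideanSpace ℝ (Fin d)))
    (V : EuclideanSpace ℝ (Fin d) → ℝ) : Prop :=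
  ∀ x ∈ Ω, ∃ U ∈ 𝓝 x, ∃ C : ℝ, ∀ y ∈ U, |V y| ≤ C

/-- The functional `Q_V(u) = (1/p) ∫_Ω (|∇u|^p + V|u|^p) dx`. -/
def Qfun {d : ℕ} (Ω : Set (EuclideanSpace ℝ (Fin d)))
    (V : EuclideanSpace ℝ (Fin d) → ℝ) (p : ℝ)
    (u : EuclideanSpace ℝ (Fin d) → ℝ) : ℝ :=
  (1 / p) * ∫ x in Ω, (‖gradient u x‖ ^ p + V x * |u x| ^ p)

/-- Weak solution of `Q'(u) = -div(|∇u|^{p-2}∇u) + V|u|^{p-2}u = 0` in `U`. -/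
def IsSolutionOn {d : ℕ} (U : Set (EuclideanSpace ℝ (Fin d)))
    (V : EuclideanSpace ℝ (Fin d) → ℝ) (p : ℝ)
    (v : EuclideanSpace ℝ (Fin d) → ℝ) : Prop :=
  ∀ φ : EuclideanSpace ℝ (Fin d) → ℝ, IsTestFun U φ →
    ∫ x in U, (‖gradient v x‖ ^ (p - 2) * ⟪gradient v x, gradient φ x⟫
      + V x * |v x| ^ (p - 2) * v x * φ x) = 0

/-- Weak supersolution of `Q'(u) = 0` in `U`. -/
def IsSupersolutionOn {d : ℕ} (U : Set (EuclideanSpace ℝ (Fin d)))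
    (V : EuclideanSpace ℝ (Fin d) → ℝ) (p : ℝ)
    (v : EuclideanSpace ℝ (Fin d) → ℝ) : Prop :=
  ∀ φ : EuclideanSpace ℝ (Fin d) → ℝ, IsTestFun U φ → (∀ x, 0 ≤ φ x) →
    0 ≤ ∫ x in U, (‖gradient v x‖ ^ (p - 2) * ⟪gradient v x, gradient φ x⟫
      + V x * |v x| ^ (p - 2) * v x * φ x)

/-- Weak subsolution of `Q'(u) = 0` in `U`. -/
def IsSubsolutionOn {d : ℕ} (U : Set (EuclideanSpace ℝ (Fin d)))
    (V : EuclideanSpace ℝ (Fin d) → ℝ) (p : ℝ)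
    (v : EuclideanSpace ℝ (Fin d) → ℝ) : Prop :=
  ∀ φ : EuclideanSpace ℝ (Fin d) → ℝ, IsTestFun U φ → (∀ x, 0 ≤ φ x) →
    ∫ x in U, (‖gradient v x‖ ^ (p - 2) * ⟪gradient v x, gradient φ x⟫
      + V x * |v x| ^ (p - 2) * v x * φ x) ≤ 0

/-- A null sequence of the functional `F`: nonnegative test functions, normalized in `L^p(B)`
for some fixed open set `B ⋐ Ω`, along which `F` tends to `0`. -/
def IsNullSeq {d : ℕ} (Ω : Set (EuclideanSpace ℝ (Fin d))) (p : ℝ)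
    (F : (EuclideanSpace ℝ (Fin d) → ℝ) → ℝ)
    (u : ℕ → EuclideanSpace ℝ (Fin d) → ℝ) : Prop :=
  (∀ k, IsTestFun Ω (u k) ∧ ∀ x, 0 ≤ u k x) ∧
  (∃ B : Set (EuclideanSpace ℝ (Fin d)), IsOpen B ∧ B.Nonempty ∧
    IsCompact (closure B) ∧ closure B ⊆ Ω ∧ ∀ k, (∫ x in B, u k x ^ p) = 1) ∧
  Tendsto (fun k => F (u k)) atTop (𝓝 0)

/-- A ground state of `F`: a positive `C¹(Ω)` function which is an `L^p_loc(Ω)` limit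
of a null sequence of `F`. -/
def IsGroundState {d : ℕ} (Ω : Set (EuclideanSpace ℝ (Fin d))) (p : ℝ)
    (F : (EuclideanSpace ℝ (Fin d) → ℝ) → ℝ)
    (v : EuclideanSpace ℝ (Fin d) → ℝ) : Prop :=
  (∀ x ∈ Ω, 0 < v x) ∧ ContDiffOn ℝ 1 v Ω ∧
  ∃ u : ℕ → EuclideanSpace ℝ (Fin d) → ℝ, IsNullSeq Ω p F u ∧
    ∀ K : Set (EuclideanSpace ℝ (Fin d)), K ⊆ Ω → IsCompact K →
      Tendsto (fun k => ∫ x in K, |u k x - v x| ^ p) atTop (𝓝 0)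

/-- Subcritical (weakly coercive): nonnegative on test functions and no ground state. -/
def IsSubcritical {d : ℕ} (Ω : Set (EuclideanSpace ℝ (Fin d))) (p : ℝ)
    (F : (EuclideanSpace ℝ (Fin d) → ℝ) → ℝ) : Prop :=
  (∀ u, IsTestFun Ω u → 0 ≤ F u) ∧ ¬ ∃ v, IsGroundState Ω p F v

/-- Critical: nonnegative on test functions and admits a ground state. -/
def IsCritical {d : ℕ} (Ω : Set (EuclideanSpace ℝ (Fin d))) (p : ℝ)
    (F : (EuclideanSpace ℝ (Fin d) → ℝ) → ℝ) : Prop :=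
  (∀ u, IsTestFun Ω u → 0 ≤ F u) ∧ ∃ v, IsGroundState Ω p F v
/-- The perturbed functional `Q̃_λ(u) = Q(u) + λ∫_Ω Ṽ|u|^p dx`. -/
def Qpert {d : ℕ} (Ω : Set (EuclideanSpace ℝ (Fin d)))
    (V Vt : EuclideanSpace ℝ (Fin d) → ℝ) (p lam : ℝ)
    (u : EuclideanSpace ℝ (Fin d) → ℝ) : ℝ :=
  Qfun Ω V p u + lam * ∫ x in Ω, Vt x * |u x| ^ p

section Elementary

variable {F : Type*} [NormedAddCommGroup F] [InnerProductSpace ℝ F]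

lemma exists_norm_add_rpow_le {p : ℝ} (hp : 1 < p) {ε : ℝ} (hε : 0 < ε) :
    ∃ C : ℝ, 0 < C ∧ ∀ a b : F, ‖a + b‖ ^ p ≤ (1 + ε) * ‖a‖ ^ p + C * ‖b‖ ^ p := by
  set r : ℝ := (1 + ε) ^ (-(1 / (p - 1))) with hr
  have hp1 : 0 < p - 1 := by linarith
  have hr0 : 0 < r := rpow_pos_of_pos (by linarith) _
  have hr1 : r < 1 := rpow_lt_one_of_one_lt_of_neg (by linarith) (by
    have := one_div_pos.2 hp1; linarith)
  have hrp : r ^ (1 - p) = 1 + ε := by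
    rw [hr, ← rpow_mul (by linarith)]
    have : -(1 / (p - 1)) * (1 - p) = 1 := by field_simp; ring
    rw [this, rpow_one]
  refine ⟨(1 - r) ^ (1 - p), rpow_pos_of_pos (by linarith) _, fun a b => ?_⟩
  have key : ∀ t x : ℝ, 0 < t → 0 ≤ x → t * (x / t) ^ p = t ^ (1 - p) * x ^ p := by
    intro t x ht hx
    rw [div_rpow hx ht.le, rpow_sub ht, rpow_one]
    ring
  have h1 : ‖a + b‖ ^ p ≤ (‖a‖ + ‖b‖) ^ p :=
    rpow_le_rpow (norm_nonneg _) (norm_add_le _ _) (by linarith)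
  have h2 := (convexOn_rpow hp.le).2 (x := ‖a‖ / r) (y := ‖b‖ / (1 - r))
    (by simp; positivity) (by simp; exact div_nonneg (norm_nonneg _) (by linarith)) hr0.le
    (by linarith : 0 ≤ 1 - r) (by ring)
  simp only [smul_eq_mul] at h2
  rw [key _ _ hr0 (norm_nonneg _), key _ _ (by linarith) (norm_nonneg _), hrp,
    mul_div_cancel₀ _ hr0.ne', mul_div_cancel₀ _ (by linarith : (1 - r) ≠ 0)] at h2
  exact h1.trans h2

lemma norm_convex_combination_rpow_le {p : ℝ} (hp : 1 < p) {η : ℝ} (h0 : 0 ≤ η) (h1 : η ≤ 1)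
    (a b : F) : ‖(1 - η) • a + η • b‖ ^ p ≤ (1 - η) * ‖a‖ ^ p + η * ‖b‖ ^ p := by
  have h2 := (convexOn_rpow hp.le).2 (x := ‖a‖) (y := ‖b‖) (norm_nonneg a) (norm_nonneg b)
    (by linarith : 0 ≤ 1 - η) h0 (by ring)
  refine le_trans (rpow_le_rpow (norm_nonneg _) ?_ (by linarith)) h2
  refine (norm_add_le _ _).trans ?_
  rw [norm_smul, norm_smul, Real.norm_of_nonneg h0, Real.norm_of_nonneg (by linarith : 0 ≤ 1 - η)]
  rfl

lemma exists_norm_cutoff_combination_rpow_le {p : ℝ} (hp : 1 < p) {ε : ℝ} (hε : 0 < ε) {N : ℕ}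
    (hN : p ≤ N) :
    ∃ C : ℝ, 0 < C ∧ ∀ (ζ : ℝ) (a b c : F), 0 ≤ ζ → ζ ≤ 1 →
      ‖(1 - ζ ^ N) • a + ζ ^ N • b + ζ ^ (N - 1) • c‖ ^ p ≤
        (1 - ζ ^ N) * ‖a‖ ^ p + (1 + ε) * (ζ ^ N * ‖b‖ ^ p) + C * ‖c‖ ^ p := by
  obtain ⟨C, hC, h⟩ := exists_norm_add_rpow_le (F := F) hp hε
  have hN2 : 1 < N := by exact_mod_cast hp.trans_le hN
  refine ⟨C, hC, fun ζ a b c h0 h1 => ?_⟩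
  rcases h0.eq_or_lt with rfl | hζ
  · have e1 : (0 : ℝ) ^ N = 0 := zero_pow (by omega)
    have e2 : (0 : ℝ) ^ (N - 1) = 0 := zero_pow (by omega)
    simp only [e1, e2, zero_smul, add_zero, sub_zero, one_smul, one_mul, zero_mul, mul_zero]
    have : 0 ≤ C * ‖c‖ ^ p := by positivity
    linarith
  have e : (1 - ζ ^ N) • a + ζ ^ N • b + ζ ^ (N - 1) • c
      = (1 - ζ ^ N) • a + ζ ^ N • (b + ζ⁻¹ • c) := by
    rw [smul_add, smul_smul, ← add_assoc]
    congr 2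
    rw [← pow_sub_one_mul (by omega : N ≠ 0) ζ]
    field_simp
  rw [e]
  refine (norm_convex_combination_rpow_le hp (by positivity) (pow_le_one₀ h0 h1) _ _).trans ?_
  have h3 := h b (ζ⁻¹ • c)
  rw [norm_smul, mul_rpow (norm_nonneg _) (norm_nonneg _), norm_inv, Real.norm_of_nonneg h0] at h3
  have h4 : ζ ^ N * ζ⁻¹ ^ p ≤ 1 := by
    rw [inv_rpow h0, ← rpow_natCast, ← rpow_neg h0, ← rpow_add hζ]
    exact rpow_le_one h0 h1 (by linarith)
  have h5 : ζ ^ N * ‖b + ζ⁻¹ • c‖ ^ p ≤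
      ζ ^ N * ((1 + ε) * ‖b‖ ^ p + C * (ζ⁻¹ ^ p * ‖c‖ ^ p)) :=
    mul_le_mul_of_nonneg_left h3 (by positivity)
  have h6 : ζ ^ N * ζ⁻¹ ^ p * (C * ‖c‖ ^ p) ≤ 1 * (C * ‖c‖ ^ p) :=
    mul_le_mul_of_nonneg_right h4 (by positivity)
  nlinarith

lemma exists_abs_rpow_sub_rpow_le {p : ℝ} (hp : 1 < p) {ε : ℝ} (hε : 0 < ε) :
    ∃ C : ℝ, 0 < C ∧ ∀ a b : ℝ, |(|a| ^ p - |b| ^ p)| ≤ ε * |b| ^ p + C * |a - b| ^ p := by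
  obtain ⟨C, hC, h⟩ := exists_norm_add_rpow_le (F := ℝ) hp hε
  refine ⟨C, hC, fun a b => ?_⟩
  have h1 := h b (a - b)
  have h2 := h a (b - a)
  simp only [Real.norm_eq_abs, add_sub_cancel] at h1 h2
  rw [abs_sub_comm b a] at h2
  have ha : 0 ≤ |a| ^ p := by positivity
  have hb : 0 ≤ |b| ^ p := by positivity
  have hc : 0 ≤ C * |a - b| ^ p := by positivity
  rw [abs_le]
  constructor
  · rcases le_total (|a| ^ p) (|b| ^ p) with hab | hab <;> nlinarith
  · linarith

lemma exists_rpow_le_add_mul_rpow {a b : ℝ} (ha : 0 < a) (hab : a < b) {s : ℝ} (hs : 0 < s) :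
    ∃ C : ℝ, 0 < C ∧ ∀ t : ℝ, 0 ≤ t → t ^ a ≤ s + C * t ^ b := by
  set r : ℝ := s ^ (1 / a) with hr
  have hr0 : 0 < r := by positivity
  have hra : r ^ a = s := by
    rw [hr, ← rpow_mul hs.le, one_div_mul_cancel ha.ne', rpow_one]
  refine ⟨r ^ (a - b), by positivity, fun t ht => ?_⟩
  rcases le_total t r with h | h
  · have := rpow_le_rpow ht h ha.le
    have : 0 ≤ r ^ (a - b) * t ^ b := by positivity
    linarith
  · have ht0 : 0 < t := hr0.trans_le h
    have h1 : t ^ (a - b) ≤ r ^ (a - b) := rpow_le_rpow_of_nonpos hr0 h (by linarith)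
    have h2 : t ^ a = t ^ (a - b) * t ^ b := by rw [← rpow_add ht0]; ring_nf
    rw [h2]
    have := mul_le_mul_of_nonneg_right h1 (by positivity : 0 ≤ t ^ b)
    linarith

lemma exists_rpow_le_mul_add_mul_rpow {p q : ℝ} (hp : 1 < p) (hpq : p < q) {s : ℝ} (hs : 0 < s) :
    ∃ C : ℝ, 0 < C ∧ ∀ t : ℝ, 0 ≤ t → t ^ p ≤ C * t + s * t ^ q := by
  set r : ℝ := s ^ (1 / (p - q)) with hr
  have hr0 : 0 < r := by positivity
  have hra : r ^ (p - q) = s := by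
    rw [hr, ← rpow_mul hs.le, one_div_mul_cancel (by linarith), rpow_one]
  refine ⟨r ^ (p - 1), by positivity, fun t ht => ?_⟩
  rcases ht.eq_or_lt with rfl | ht0
  · rw [zero_rpow (by linarith), zero_rpow (by linarith)]; simp
  rcases le_total t r with h | h
  · have h1 : t ^ (p - 1) ≤ r ^ (p - 1) := rpow_le_rpow ht h (by linarith)
    have h2 : t ^ p = t ^ (p - 1) * t := by
      rw [rpow_sub ht0, rpow_one]; field_simp
    rw [h2]
    have := mul_le_mul_of_nonneg_right h1 ht
    have : 0 ≤ s * t ^ q := by positivity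
    linarith
  · have h1 : t ^ (p - q) ≤ r ^ (p - q) := rpow_le_rpow_of_nonpos hr0 h (by linarith)
    have h2 : t ^ p = t ^ (p - q) * t ^ q := by rw [← rpow_add ht0]; ring_nf
    rw [h2]
    have := mul_le_mul_of_nonneg_right h1 (by positivity : 0 ≤ t ^ q)
    have : 0 ≤ r ^ (p - 1) * t := by positivity
    rw [hra] at *
    linarith

/-- The duality map `Y ↦ |Y|^{p-2} Y`. -/
def dualityMap (p : ℝ) (Y : F) : F := ‖Y‖ ^ (p - 2) • Y

lemma norm_rpow_sub_two_mul_sq {p : ℝ} (hp : 1 < p) (Y : F) :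
    ‖Y‖ ^ (p - 2) * ‖Y‖ ^ 2 = ‖Y‖ ^ p := by
  rcases eq_or_ne Y 0 with rfl | hY
  · simp [zero_rpow (by linarith : p ≠ 0)]
  · have : 0 < ‖Y‖ := norm_pos_iff.2 hY
    rw [← rpow_natCast, ← rpow_add this]; norm_num

lemma inner_dualityMap_self {p : ℝ} (hp : 1 < p) (Y : F) : ⟪dualityMap p Y, Y⟫ = ‖Y‖ ^ p := by
  rw [dualityMap, inner_smul_left, real_inner_self_eq_norm_sq]
  exact norm_rpow_sub_two_mul_sq hp Y

lemma norm_dualityMap {p : ℝ} (hp : 1 < p) (Y : F) : ‖dualityMap p Y‖ = ‖Y‖ ^ (p - 1) := by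
  rw [dualityMap, norm_smul, Real.norm_of_nonneg (by positivity)]
  rcases eq_or_ne Y 0 with rfl | hY
  · simp [zero_rpow (by linarith : p - 1 ≠ 0)]
  · have : 0 < ‖Y‖ := norm_pos_iff.2 hY
    nth_rw 2 [← rpow_one ‖Y‖]
    rw [← rpow_add this]; congr 1; ring

lemma norm_dualityMap_rpow {p : ℝ} (hp : 1 < p) (Y : F) :
    ‖dualityMap p Y‖ ^ (p / (p - 1)) = ‖Y‖ ^ p := by
  rw [norm_dualityMap hp, ← rpow_mul (norm_nonneg _)]
  congr 1
  have : p - 1 ≠ 0 := by linarith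
  field_simp

lemma dualityMap_smul (p t : ℝ) (Y : F) :
    dualityMap p (t • Y) = (|t| ^ (p - 2) * t) • dualityMap p Y := by
  rw [dualityMap, dualityMap, norm_smul, mul_rpow (norm_nonneg _) (norm_nonneg _), smul_smul,
    smul_smul, Real.norm_eq_abs]
  congr 1; ring

lemma continuous_dualityMap [CompleteSpace F] {p : ℝ} (hp : 1 < p) :
    Continuous (dualityMap p : F → F) := by
  have h := (contDiff_norm_rpow (E := F) hp).continuous_fderiv one_ne_zero
  have h2 : (dualityMap p : F → F) = fun x =>
      (1 / p) • (InnerProductSpace.toDual ℝ F).symm (fderiv ℝ (fun x : F => ‖x‖ ^ p) x) := by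
    ext1 x
    have e : fderiv ℝ (fun x : F => ‖x‖ ^ p) x
        = InnerProductSpace.toDual ℝ F ((p * ‖x‖ ^ (p - 2)) • x) := by
      rw [(hasFDerivAt_norm_rpow x hp).fderiv]
      ext y
      simp
    rw [e, LinearIsometryEquiv.symm_apply_apply, dualityMap, smul_smul]
    congr 1
    field_simp
  rw [h2]
  exact ((InnerProductSpace.toDual ℝ F).symm.continuous.comp h).const_smul _

lemma mul_inner_le_norm_rpow_add {p : ℝ} (hp : 1 < p) (H a : F) :
    p * ⟪H, a⟫ ≤ ‖a‖ ^ p + (p - 1) * ‖H‖ ^ (p / (p - 1)) := by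
  have hq : (p).HolderConjugate (p / (p - 1)) := Real.HolderConjugate.conjExponent hp
  have h1 := Real.young_inequality_of_nonneg (norm_nonneg a) (norm_nonneg H) hq
  have h2 := real_inner_le_norm H a
  have h3 : p - 1 ≠ 0 := by linarith
  have h4 : p * (‖a‖ ^ p / p + ‖H‖ ^ (p / (p - 1)) / (p / (p - 1)))
      = ‖a‖ ^ p + (p - 1) * ‖H‖ ^ (p / (p - 1)) := by
    field_simp
  rw [← h4]
  apply mul_le_mul_of_nonneg_left _ (by linarith)
  linarith [mul_comm ‖a‖ ‖H‖]

/-- The Bregman distance of `|·|^p`. -/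
def bregman (p : ℝ) (X Y : F) : ℝ := ‖X‖ ^ p - ‖Y‖ ^ p - p * ⟪dualityMap p Y, X - Y⟫

lemma bregman_nonneg {p : ℝ} (hp : 1 < p) (X Y : F) : 0 ≤ bregman p X Y := by
  have h := mul_inner_le_norm_rpow_add hp (dualityMap p Y) X
  rw [norm_dualityMap_rpow hp] at h
  rw [bregman, inner_sub_right, inner_dualityMap_self hp]
  linarith

lemma norm_midpoint_rpow_lt {p : ℝ} (hp : 1 < p) {X Y : F} (h : X ≠ Y) :
    ‖(1 / 2 : ℝ) • X + (1 / 2 : ℝ) • Y‖ ^ p < (‖X‖ ^ p + ‖Y‖ ^ p) / 2 := by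
  by_cases hn : ‖X‖ = ‖Y‖
  · have := norm_combo_lt_of_ne (E := F) (le_refl ‖X‖) hn.ge h (a := 1 / 2) (b := 1 / 2)
      (by norm_num) (by norm_num) (by norm_num)
    have := rpow_lt_rpow (norm_nonneg _) this (by linarith : 0 < p)
    rw [← hn]; linarith
  · have h1 := (strictConvexOn_rpow hp).2 (x := ‖X‖) (norm_nonneg X) (y := ‖Y‖) (norm_nonneg Y) hn
      (by norm_num : (0 : ℝ) < 1 / 2) (by norm_num : (0 : ℝ) < 1 / 2) (by norm_num)
    have h2 : ‖(1 / 2 : ℝ) • X + (1 / 2 : ℝ) • Y‖ ≤ 1 / 2 * ‖X‖ + 1 / 2 * ‖Y‖ := by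
      refine (norm_add_le _ _).trans ?_
      rw [norm_smul, norm_smul]; norm_num
    have h3 := rpow_le_rpow (norm_nonneg _) h2 (by linarith : 0 ≤ p)
    simp only [smul_eq_mul] at h1
    linarith

lemma bregman_pos {p : ℝ} (hp : 1 < p) {X Y : F} (h : X ≠ Y) : 0 < bregman p X Y := by
  have h1 := bregman_nonneg hp ((1 / 2 : ℝ) • X + (1 / 2 : ℝ) • Y) Y
  have h2 := norm_midpoint_rpow_lt hp h
  have h3 : (1 / 2 : ℝ) • X + (1 / 2 : ℝ) • Y - Y = (1 / 2 : ℝ) • (X - Y) := by module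
  rw [bregman, h3, inner_smul_right] at h1
  rw [bregman]
  linarith

lemma bregman_smul {p : ℝ} {t : ℝ} (ht : 0 < t) (X Y : F) :
    bregman p (t • X) (t • Y) = t ^ p * bregman p X Y := by
  rw [bregman, bregman, dualityMap_smul, ← smul_sub, inner_smul_left, inner_smul_right,
    norm_smul, norm_smul, mul_rpow (norm_nonneg _) (norm_nonneg _),
    mul_rpow (norm_nonneg _) (norm_nonneg _), Real.norm_of_nonneg ht.le, abs_of_pos ht]
  have : t ^ (p - 2) * t * t = t ^ p := by
    nth_rw 2 [← rpow_one t]; nth_rw 3 [← rpow_one t]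
    rw [← rpow_add ht, ← rpow_add ht]; congr 1; ring
  simp only [conj_trivial]
  linear_combination (-p * ⟪dualityMap p Y, X - Y⟫) * this

lemma exists_norm_sub_rpow_le_bregman [FiniteDimensional ℝ F] {p : ℝ} (hp : 1 < p) {ε : ℝ}
    (hε : 0 < ε) :
    ∃ C : ℝ, 0 ≤ C ∧ ∀ X Y : F, ‖X - Y‖ ^ p ≤ ε * ‖Y‖ ^ p + C * bregman p X Y := by
  have hp0 : (0 : ℝ) ≤ p := by linarith
  set f : F × F → ℝ := fun z => ‖z.1 - z.2‖ ^ p - ε * ‖z.2‖ ^ p with hf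
  set g : F × F → ℝ := fun z => bregman p z.1 z.2 with hg
  have hJ := continuous_dualityMap (F := F) hp
  have hfc : Continuous f := by
    apply Continuous.sub
    · exact (continuous_fst.sub continuous_snd).norm.rpow_const fun _ => Or.inr hp0
    · exact continuous_const.mul (continuous_snd.norm.rpow_const fun _ => Or.inr hp0)
  have hgc : Continuous g := by
    apply Continuous.sub
    · exact (continuous_fst.norm.rpow_const fun _ => Or.inr hp0).sub
        (continuous_snd.norm.rpow_const fun _ => Or.inr hp0)
    · exact continuous_const.mul ((hJ.comp continuous_snd).inner
        (continuous_fst.sub continuous_snd))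
  set T : Set (F × F) := Metric.sphere 0 1 ∩ {z | 0 ≤ f z} with hT
  have hTc : IsCompact T := (isCompact_sphere _ _).inter_right (isClosed_le continuous_const hfc)
  have hgT : ∀ z ∈ T, 0 < g z := by
    rintro ⟨X, Y⟩ ⟨hz1, hz2⟩
    refine bregman_pos hp fun hXY => ?_
    change X = Y at hXY
    subst hXY
    simp only [hf, Set.mem_ofPred_eq, sub_self, norm_zero, zero_rpow (by linarith : p ≠ 0)] at hz2
    have hX : X ≠ 0 := by
      rintro rfl
      simp at hz1
    have : 0 < ‖X‖ := norm_pos_iff.2 hX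
    have : 0 < ε * ‖X‖ ^ p := by positivity
    linarith
  obtain ⟨C, hC0, hC⟩ : ∃ C : ℝ, 0 ≤ C ∧ ∀ z ∈ T, f z ≤ C * g z := by
    have hcont : ContinuousOn (fun z => f z / g z) T :=
      hfc.continuousOn.div hgc.continuousOn fun z hz => (hgT z hz).ne'
    obtain ⟨M, hM⟩ := hTc.bddAbove_image hcont
    refine ⟨max M 0, le_max_right _ _, fun z hz => ?_⟩
    rw [← div_le_iff₀ (hgT z hz)]
    exact (hM ⟨z, hz, rfl⟩).trans (le_max_left _ _)
  refine ⟨C, hC0, fun X Y => ?_⟩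
  by_cases h0 : (X, Y) = (0 : F × F)
  · obtain ⟨rfl, rfl⟩ := Prod.mk.inj h0
    simp [bregman, zero_rpow (by linarith : p ≠ 0)]
  set t : ℝ := ‖(X, Y)‖ with ht
  have ht0 : 0 < t := norm_pos_iff.2 h0
  have hfg : f (t⁻¹ • (X, Y)) ≤ C * g (t⁻¹ • (X, Y)) := by
    by_cases hneg : 0 ≤ f (t⁻¹ • (X, Y))
    · refine hC _ ⟨?_, hneg⟩
      simp only [mem_sphere_iff_norm, sub_zero]
      rw [norm_smul, norm_inv, Real.norm_of_nonneg ht0.le, ← ht, inv_mul_cancel₀ ht0.ne']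
    · have : 0 ≤ C * g (t⁻¹ • (X, Y)) := mul_nonneg hC0 (bregman_nonneg hp _ _)
      linarith
  have hti : 0 < t⁻¹ := inv_pos.2 ht0
  simp only [hf, hg, Prod.smul_mk] at hfg
  rw [bregman_smul hti, ← smul_sub, norm_smul, norm_smul, Real.norm_of_nonneg hti.le,
    mul_rpow hti.le (norm_nonneg _), mul_rpow hti.le (norm_nonneg _)] at hfg
  have htp : 0 < t⁻¹ ^ p := by positivity
  have : t⁻¹ ^ p * (‖X - Y‖ ^ p - ε * ‖Y‖ ^ p) ≤ t⁻¹ ^ p * (C * bregman p X Y) := by linarith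
  have := le_of_mul_le_mul_left this htp
  linarith

end Elementary

section Gradient

variable {F : Type*} [NormedAddCommGroup F] [InnerProductSpace ℝ F] [CompleteSpace F]
  {f g : F → ℝ} {f' g' x : F}

lemma HasGradientAt.add' (hf : HasGradientAt f f' x) (hg : HasGradientAt g g' x) :
    HasGradientAt (fun y => f y + g y) (f' + g') x := by
  rw [hasGradientAt_iff_hasFDerivAt] at *
  rw [map_add]
  exact hf.add hg

lemma HasGradientAt.sub' (hf : HasGradientAt f f' x) (hg : HasGradientAt g g' x) :
    HasGradientAt (fun y => f y - g y) (f' - g') x := by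
  rw [hasGradientAt_iff_hasFDerivAt] at *
  rw [map_sub]
  exact hf.sub hg

lemma HasGradientAt.mul' (hf : HasGradientAt f f' x) (hg : HasGradientAt g g' x) :
    HasGradientAt (fun y => f y * g y) (f x • g' + g x • f') x := by
  rw [hasGradientAt_iff_hasFDerivAt] at *
  rw [map_add, map_smul, map_smul]
  exact hf.mul hg

lemma HasGradientAt.scomp {h : ℝ → ℝ} {h' : ℝ} (hf : HasGradientAt f f' x)
    (hh : HasDerivAt h h' (f x)) : HasGradientAt (fun y => h (f y)) (h' • f') x := by
  rw [hasGradientAt_iff_hasFDerivAt] at *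
  rw [map_smul]
  exact hh.comp_hasFDerivAt x hf

lemma ContDiff.hasGradientAt (hf : ContDiff ℝ 1 f) (x : F) : HasGradientAt f (gradient f x) x :=
  (hf.differentiable one_ne_zero x).hasGradientAt

lemma ContDiff.continuous_gradient (hf : ContDiff ℝ 1 f) : Continuous (gradient f) :=
  (InnerProductSpace.toDual ℝ F).symm.continuous.comp (hf.continuous_fderiv one_ne_zero)

lemma norm_gradient (f : F → ℝ) (x : F) : ‖gradient f x‖ = ‖fderiv ℝ f x‖ :=
  LinearIsometryEquiv.norm_map _ _

lemma gradient_eq_zero_of_notMem_tsupport (h : x ∉ tsupport f) : gradient f x = 0 := by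
  have : f =ᶠ[𝓝 x] fun _ => 0 := notMem_tsupport_iff_eventuallyEq.1 h
  rw [this.gradient_eq]
  exact gradient_fun_const x 0

end Gradient

section TestFunctions

variable {d : ℕ} {Ω : Set (EuclideanSpace ℝ (Fin d))}

/-- A continuously differentiable function with compact support inside `Ω`. -/
structure IsC1Test (Ω : Set (EuclideanSpace ℝ (Fin d)))
    (u : EuclideanSpace ℝ (Fin d) → ℝ) : Prop where
  contDiff : ContDiff ℝ 1 u
  compact : HasCompactSupport u
  subset : tsupport u ⊆ Ω

lemma IsTestFun.isC1Test {u : EuclideanSpace ℝ (Fin d) → ℝ} (h : IsTestFun Ω u) :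
    IsC1Test Ω u :=
  ⟨h.1.of_le (by exact_mod_cast le_top), h.2.1, h.2.2⟩

lemma IsC1Test.add {u w : EuclideanSpace ℝ (Fin d) → ℝ} (hu : IsC1Test Ω u)
    (hw : IsC1Test Ω w) : IsC1Test Ω (fun x => u x + w x) :=
  ⟨hu.contDiff.add hw.contDiff, hu.compact.add hw.compact,
    (tsupport_add u w).trans (Set.union_subset hu.subset hw.subset)⟩

lemma IsC1Test.sub {u w : EuclideanSpace ℝ (Fin d) → ℝ} (hu : IsC1Test Ω u)
    (hw : IsC1Test Ω w) : IsC1Test Ω (fun x => u x - w x) :=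
  ⟨hu.contDiff.sub hw.contDiff, hu.compact.sub hw.compact,
    (tsupport_sub u w).trans (Set.union_subset hu.subset hw.subset)⟩

lemma IsC1Test.mul_right {u : EuclideanSpace ℝ (Fin d) → ℝ} (hu : IsC1Test Ω u)
    {f : EuclideanSpace ℝ (Fin d) → ℝ} (hf : ContDiff ℝ 1 f) :
    IsC1Test Ω (fun x => f x * u x) :=
  ⟨hf.mul hu.contDiff, hu.compact.mul_left, (tsupport_mul_subset_right).trans hu.subset⟩

/-- A function that is `C¹` on `Ω` times one that vanishes off a compact subset is `C¹`. -/
lemma IsC1Test.of_contDiffOn (hΩ : IsOpen Ω) {u w : EuclideanSpace ℝ (Fin d) → ℝ}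
    (hu : ContDiffOn ℝ 1 u Ω) (hw : IsC1Test Ω w) (hsupp : ∀ x, w x = 0 → u x = 0) :
    IsC1Test Ω u := by
  have hs : tsupport u ⊆ tsupport w := closure_mono fun x hx h => hx (hsupp x h)
  refine ⟨contDiff_iff_contDiffAt.2 fun x => ?_, ?_, hs.trans hw.subset⟩
  · by_cases hx : x ∈ tsupport w
    · exact hu.contDiffAt (hΩ.mem_nhds (hw.subset hx))
    · have : u =ᶠ[𝓝 x] fun _ => 0 :=
        notMem_tsupport_iff_eventuallyEq.1 fun h => hx (hs h)
      exact contDiffAt_const.congr_of_eventuallyEq this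
  · exact hw.compact.of_isClosed_subset (isClosed_tsupport _) hs

lemma exists_isTestFun_one_nhds (hΩ : IsOpen Ω) {K : Set (EuclideanSpace ℝ (Fin d))}
    (hK : IsCompact K) (hKΩ : K ⊆ Ω) :
    ∃ ζ, IsTestFun Ω ζ ∧ (∀ x, 0 ≤ ζ x) ∧ (∀ x, ζ x ≤ 1) ∧ ∀ x ∈ K, ∀ᶠ y in 𝓝 x, ζ y = 1 := by
  obtain ⟨δ, hδ, hsub⟩ := hK.exists_cthickening_subset_open hΩ hKΩ
  obtain ⟨f, h1, h2, h3⟩ := exists_contMDiffMap_one_nhds_of_subset_interior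
    (n := (⊤ : ℕ∞)) (modelWithCornersSelf ℝ (EuclideanSpace ℝ (Fin d)))
    (s := K) (t := Metric.cthickening δ K) hK.isClosed
    ((Metric.self_subset_thickening hδ K).trans
      (Metric.isOpen_thickening.subset_interior_iff.2 (Metric.thickening_subset_cthickening δ K)))
  have hts : tsupport f ⊆ Metric.cthickening δ K := by
    refine closure_minimal (fun x hx => ?_) Metric.isClosed_cthickening
    by_contra h
    exact hx (h2 x h)
  refine ⟨f, ⟨f.contMDiff.contDiff, ?_, hts.trans hsub⟩, fun x => (h3 x).1, fun x => (h3 x).2,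
    fun x hx => ?_⟩
  · exact hK.cthickening.of_isClosed_subset (isClosed_tsupport _) hts
  · exact (eventually_nhdsSet_iff_forall.1 h1) x hx

/-- `C¹` functions with compact support are limits in `C¹` of test functions, with supports in
a fixed compact set. -/
lemma IsC1Test.exists_approx (hΩ : IsOpen Ω) {u : EuclideanSpace ℝ (Fin d) → ℝ}
    (hu : IsC1Test Ω u) :
    ∃ K, IsCompact K ∧ K ⊆ Ω ∧ tsupport u ⊆ K ∧ ∀ ε > 0, ∃ w, IsTestFun Ω w ∧ tsupport w ⊆ K ∧
      (∀ x, |w x - u x| ≤ ε) ∧ ∀ x, ‖gradient w x - gradient u x‖ ≤ ε := by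
  have hucs : IsCompact (tsupport u) := hu.compact
  obtain ⟨δ, hδ, hsub⟩ := hucs.exists_cthickening_subset_open hΩ hu.subset
  refine ⟨Metric.cthickening δ (tsupport u), hucs.cthickening, hsub,
    Metric.self_subset_cthickening _, fun ε hε => ?_⟩
  have huc : UniformContinuous u := hu.compact.uniformContinuous_of_continuous hu.contDiff.continuous
  have hduc : UniformContinuous (fderiv ℝ u) :=
    (hu.compact.fderiv ℝ).uniformContinuous_of_continuous (hu.contDiff.continuous_fderiv one_ne_zero)
  obtain ⟨r1, hr1, h1⟩ := Metric.uniformContinuous_iff.1 huc ε hε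
  obtain ⟨r2, hr2, h2⟩ := Metric.uniformContinuous_iff.1 hduc ε hε
  set r := min δ (min r1 r2) with hr
  have hr0 : 0 < r := by positivity
  let φ : ContDiffBump (0 : EuclideanSpace ℝ (Fin d)) := ⟨r / 2, r, by positivity, by linarith⟩
  set w := MeasureTheory.convolution (φ.normed volume) u (ContinuousLinearMap.lsmul ℝ ℝ) volume
    with hw
  have hφs : ContDiff ℝ ((⊤ : ℕ∞) : WithTop ℕ∞) (φ.normed volume) := φ.contDiff_normed
  have hsupp : Function.support w ⊆ Metric.cthickening δ (tsupport u) := by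
    refine (support_convolution_subset _).trans ?_
    rw [φ.support_normed_eq]
    rintro _ ⟨a, ha, b, hb, rfl⟩
    refine Metric.mem_cthickening_of_dist_le _ b _ _ (subset_tsupport _ hb) ?_
    have : ‖a‖ < r := by simpa using ha
    simp only [dist_eq_norm, add_sub_cancel_right]
    exact this.le.trans (min_le_left _ _)
  have hts : tsupport w ⊆ Metric.cthickening δ (tsupport u) :=
    closure_minimal hsupp Metric.isClosed_cthickening
  refine ⟨w, ⟨?_, ?_, hts.trans hsub⟩, hts, fun x => ?_, fun x => ?_⟩
  · exact φ.hasCompactSupport_normed.contDiff_convolution_left _ hφs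
      hu.contDiff.continuous.locallyIntegrable
  · exact hucs.cthickening.of_isClosed_subset (isClosed_tsupport _) hts
  · rw [← Real.dist_eq]
    refine φ.dist_normed_convolution_le hu.contDiff.continuous.aestronglyMeasurable fun y hy => ?_
    exact (h1 ((Metric.mem_ball.1 hy).trans_le ((min_le_right _ _).trans (min_le_left _ _)))).le
  · have hd := (hu.compact.hasFDerivAt_convolution_right (ContinuousLinearMap.lsmul ℝ ℝ)
      ((φ.continuous_normed (μ := volume)).locallyIntegrable (μ := volume)) hu.contDiff x).fderiv
    have e : gradient w x - gradient u x
        = (InnerProductSpace.toDual ℝ _).symm (fderiv ℝ w x - fderiv ℝ u x) := by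
      rw [map_sub]; rfl
    rw [e, LinearIsometryEquiv.norm_map, hd, ← dist_eq_norm]
    have e2 : MeasureTheory.convolution (φ.normed volume) (fderiv ℝ u)
        (ContinuousLinearMap.precompR (EuclideanSpace ℝ (Fin d)) (ContinuousLinearMap.lsmul ℝ ℝ))
          volume
        = MeasureTheory.convolution (φ.normed volume) (fderiv ℝ u)
          (ContinuousLinearMap.lsmul ℝ ℝ) volume := by
      ext1 y
      refine integral_congr_ae (Eventually.of_forall fun t => ?_)
      ext z
      simp [ContinuousLinearMap.precompR_apply]
    rw [e2]
    refine φ.dist_normed_convolution_le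
      (hu.contDiff.continuous_fderiv one_ne_zero).aestronglyMeasurable fun y hy => ?_
    exact (h2 ((Metric.mem_ball.1 hy).trans_le ((min_le_right _ _).trans (min_le_right _ _)))).le

end TestFunctions

section Potentials

variable {d : ℕ} {Ω : Set (EuclideanSpace ℝ (Fin d))}

lemma LocBddOn.exists_bound {V : EuclideanSpace ℝ (Fin d) → ℝ} (hV : LocBddOn Ω V)
    {K : Set (EuclideanSpace ℝ (Fin d))} (hK : IsCompact K) (hKΩ : K ⊆ Ω) :
    ∃ C, 0 ≤ C ∧ ∀ x ∈ K, |V x| ≤ C := by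
  refine hK.induction_on (p := fun s => ∃ C, 0 ≤ C ∧ ∀ x ∈ s, |V x| ≤ C) ⟨0, le_rfl, by simp⟩
    ?_ ?_ ?_
  · rintro s t hst ⟨C, h0, h⟩
    exact ⟨C, h0, fun x hx => h x (hst hx)⟩
  · rintro s t ⟨C, h0, h⟩ ⟨D, h1, h'⟩
    exact ⟨max C D, le_max_of_le_left h0, fun x hx =>
      hx.elim (fun hx => le_max_of_le_left (h x hx)) fun hx => le_max_of_le_right (h' x hx)⟩
  · intro x hx
    obtain ⟨U, hU, C, hC⟩ := hV x (hKΩ hx)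
    exact ⟨U, mem_nhdsWithin_of_mem_nhds hU, C, (abs_nonneg _).trans (hC x (mem_of_mem_nhds hU)), hC⟩

lemma LocBddOn.integrableOn_mul {V : EuclideanSpace ℝ (Fin d) → ℝ} (hV : LocBddOn Ω V)
    (hVm : AEStronglyMeasurable V (volume.restrict Ω)) {h : EuclideanSpace ℝ (Fin d) → ℝ}
    (hh : IntegrableOn h Ω) {K : Set (EuclideanSpace ℝ (Fin d))} (hK : IsCompact K)
    (hKΩ : K ⊆ Ω) (hhK : ∀ x ∉ K, h x = 0) :
    IntegrableOn (fun x => V x * h x) Ω := by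
  obtain ⟨C, hC0, hC⟩ := hV.exists_bound hK hKΩ
  refine Integrable.mono' (hh.norm.const_mul C) (hVm.mul hh.aestronglyMeasurable)
    (Eventually.of_forall fun x => ?_)
  rw [norm_mul, Real.norm_eq_abs]
  by_cases hx : x ∈ K
  · exact mul_le_mul_of_nonneg_right (hC x hx) (norm_nonneg _)
  · simp [hhK x hx]

lemma exists_pos_le_of_isCompact {W : EuclideanSpace ℝ (Fin d) → ℝ} (hWc : ContinuousOn W Ω)
    (hWpos : ∀ x ∈ Ω, 0 < W x) {K : Set (EuclideanSpace ℝ (Fin d))} (hK : IsCompact K)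
    (hKΩ : K ⊆ Ω) : ∃ m > 0, ∀ x ∈ K, m ≤ W x := by
  rcases K.eq_empty_or_nonempty with rfl | hne
  · exact ⟨1, one_pos, by simp⟩
  · obtain ⟨x, hx, h⟩ := hK.exists_isMinOn hne (hWc.mono hKΩ)
    exact ⟨W x, hWpos x (hKΩ hx), fun y hy => h hy⟩

/-- A function is measurable on `Ω` once its products with powers of continuous functions
approximating a positive function in `L^p_loc` are. -/
lemma aestronglyMeasurable_of_mul_approx (hΩ : IsOpen Ω) {p : ℝ} (hp : 0 < p)
    {v : EuclideanSpace ℝ (Fin d) → ℝ}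
    (hv : ContinuousOn v Ω) (hv0 : ∀ x ∈ Ω, 0 < v x) {u : ℕ → EuclideanSpace ℝ (Fin d) → ℝ}
    (hu : ∀ k, Continuous (u k))
    (hconv : ∀ K : Set (EuclideanSpace ℝ (Fin d)), K ⊆ Ω → IsCompact K →
      Tendsto (fun k => ∫ x in K, |u k x - v x| ^ p) atTop (𝓝 0))
    {f : EuclideanSpace ℝ (Fin d) → ℝ}
    (hf : ∀ᶠ k in atTop, AEStronglyMeasurable (fun x => f x * |u k x| ^ p) (volume.restrict Ω)) :
    AEStronglyMeasurable f (volume.restrict Ω) := by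
  obtain ⟨k₀, hk₀⟩ := eventually_atTop.1 hf
  set T : ℕ → Set (EuclideanSpace ℝ (Fin d)) := fun k => {x | u (k + k₀) x ≠ 0}
  have hT : ∀ k, MeasurableSet (T k) := fun k =>
    (isOpen_ne_fun (hu (k + k₀)) continuous_const).measurableSet
  have hfT : ∀ k, AEStronglyMeasurable f ((volume.restrict Ω).restrict (T k)) := by
    intro k
    have h1 := ((hk₀ (k + k₀) (Nat.le_add_left _ _)).restrict (s := T k)).mul
      (((hu (k + k₀)).measurable.abs.pow_const p).inv.aestronglyMeasurable
        (μ := (volume.restrict Ω).restrict (T k)))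
    refine h1.congr ?_
    filter_upwards [ae_restrict_mem (hT k)] with x hx
    have : |u (k + k₀) x| ^ p ≠ 0 := (Real.rpow_pos_of_pos (abs_pos.2 hx) p).ne'
    simp [this]
  have hS : AEStronglyMeasurable f ((volume.restrict Ω).restrict (⋃ k, T k)) :=
    aestronglyMeasurable_iUnion_iff.2 hfT
  have hnull : volume (Ω \ ⋃ k, T k) = 0 := by
    refine measure_null_of_locally_null _ fun x hx => ?_
    obtain ⟨r, hr, hrΩ⟩ := Metric.nhds_basis_closedBall.mem_iff.1 (hΩ.mem_nhds hx.1)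
    set K := Metric.closedBall x r
    have hK : IsCompact K := isCompact_closedBall x r
    refine ⟨K \ ⋃ k, T k, ?_, ?_⟩
    · have : K ∩ (Ω \ ⋃ k, T k) ⊆ K \ ⋃ k, T k := fun y hy => ⟨hy.1, hy.2.2⟩
      refine mem_of_superset (inter_mem (mem_nhdsWithin_of_mem_nhds
        (Metric.closedBall_mem_nhds x hr)) self_mem_nhdsWithin) this
    · obtain ⟨m, hm, hmv⟩ := exists_pos_le_of_isCompact hv hv0 hK hrΩ
      have hms : MeasurableSet (K \ ⋃ k, T k) :=
        hK.isClosed.measurableSet.diff (MeasurableSet.iUnion hT)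
      have hfin : volume (K \ ⋃ k, T k) ≠ ⊤ :=
        ((measure_mono Set.sdiff_subset).trans_lt hK.measure_lt_top).ne
      have hle : ∀ k, m ^ p * volume.real (K \ ⋃ k, T k) ≤
          ∫ x in K, |u (k + k₀) x - v x| ^ p := by
        intro k
        have hint : IntegrableOn (fun x => |u (k + k₀) x - v x| ^ p) K := by
          refine ContinuousOn.integrableOn_compact hK ?_
          exact (((hu _).continuousOn.sub (hv.mono hrΩ)).abs).rpow_const fun _ _ => Or.inr hp.le
        refine le_trans ?_ (setIntegral_mono_set (s := K \ ⋃ k, T k) hint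
          (Eventually.of_forall fun x => by positivity) Set.sdiff_subset.eventuallyLE)
        refine setIntegral_ge_of_const_le_real hms hfin (fun y hy => ?_)
          (hint.mono_set Set.sdiff_subset)
        have h0 : u (k + k₀) y = 0 := by
          by_contra h
          exact hy.2 (Set.mem_iUnion.2 ⟨k, h⟩)
        have := hmv y hy.1
        rw [h0, zero_sub, abs_neg, abs_of_pos (hm.trans_le this)]
        gcongr
      have hlim := (tendsto_add_atTop_iff_nat k₀).2 (hconv K hrΩ hK)
      have h0 : m ^ p * volume.real (K \ ⋃ k, T k) ≤ 0 := ge_of_tendsto' hlim hle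
      have h1 : volume.real (K \ ⋃ k, T k) = 0 :=
        le_antisymm (nonpos_of_mul_nonpos_right h0 (by positivity)) measureReal_nonneg
      exact (measureReal_eq_zero_iff hfin).1 h1
  have hres : (volume.restrict Ω).restrict (⋃ k, T k) = volume.restrict Ω := by
    refine Measure.restrict_eq_self_of_ae_mem ?_
    rw [ae_restrict_iff' hΩ.measurableSet, ae_iff]
    refine measure_mono_null (fun x hx => ?_) hnull
    simpa using hx
  rwa [hres] at hS

lemma IsC1Test.integrableOn_rpow {u : EuclideanSpace ℝ (Fin d) → ℝ} (hu : IsC1Test Ω u) {p : ℝ}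
    (hp : 0 < p) : Integrable fun x => |u x| ^ p := by
  refine (hu.contDiff.continuous.abs.rpow_const fun _ => Or.inr hp.le).integrable_of_hasCompactSupport
    (hu.compact.mono fun x hx h => hx ?_)
  simp [h, hp.ne']

lemma IsC1Test.integrable_gradient_rpow {u : EuclideanSpace ℝ (Fin d) → ℝ} (hu : IsC1Test Ω u)
    {p : ℝ} (hp : 0 < p) : Integrable fun x => ‖gradient u x‖ ^ p := by
  refine (hu.contDiff.continuous_gradient.norm.rpow_const fun _ =>
    Or.inr hp.le).integrable_of_hasCompactSupport
    (hu.compact.mono' fun x hx => by_contra fun h => hx ?_)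
  simp [gradient_eq_zero_of_notMem_tsupport h, hp.ne']

/-- Integrability of a continuous weight on `Ω` times a power of a test function. -/
lemma IsC1Test.integrableOn_mul_rpow {u W : EuclideanSpace ℝ (Fin d) → ℝ} (hΩ : IsOpen Ω)
    (hu : IsC1Test Ω u) (hW : ContinuousOn W Ω) {q : ℝ} (hq : 0 < q) :
    IntegrableOn (fun x => W x * |u x| ^ q) Ω := by
  have h1 : IntegrableOn (fun x => W x * |u x| ^ q) (tsupport u) :=
    ContinuousOn.integrableOn_compact hu.compact ((hW.mono hu.subset).mul
      (hu.contDiff.continuous.abs.rpow_const fun _ => Or.inr hq.le).continuousOn)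
  refine h1.of_forall_sdiff_eq_zero hΩ.measurableSet fun x hx => ?_
  simp [image_eq_zero_of_notMem_tsupport hx.2, hq.ne']

lemma exists_pos_le_weighted_integral (hΩ : IsOpen Ω) {p q : ℝ} (hp : 1 < p) (hpq : p < q)
    {W : EuclideanSpace ℝ (Fin d) → ℝ} (hWc : ContinuousOn W Ω) (hWpos : ∀ x ∈ Ω, 0 < W x)
    {B : Set (EuclideanSpace ℝ (Fin d))} (hB : IsOpen B) (hBc : IsCompact (closure B))
    (hBΩ : closure B ⊆ Ω) :
    ∃ c > 0, ∀ u, IsTestFun Ω u → (∀ x, 0 ≤ u x) → (∫ x in B, u x ^ p) = 1 →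
      c ≤ ∫ x in Ω, W x * |u x| ^ q := by
  obtain ⟨m, hm, hmW⟩ := exists_pos_le_of_isCompact hWc hWpos hBc hBΩ
  have hfin : volume B ≠ ⊤ := ((measure_mono subset_closure).trans_lt hBc.measure_lt_top).ne
  have hs : 0 < 1 / (2 * (volume.real B + 1)) := by
    have : 0 ≤ volume.real B := measureReal_nonneg
    positivity
  obtain ⟨C, hC, h⟩ := exists_rpow_le_add_mul_rpow (by linarith : 0 < p) hpq hs
  refine ⟨m / (2 * C), by positivity, fun u hu hu0 h1 => ?_⟩
  have hi := hu.isC1Test.integrableOn_mul_rpow hΩ hWc (by linarith : 0 < q)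
  have hiB := hi.mono_set (subset_closure.trans hBΩ)
  have key : (∫ x in B, u x ^ p) ≤
      ∫ x in B, (1 / (2 * (volume.real B + 1)) + C / m * (W x * |u x| ^ q)) := by
    refine setIntegral_mono_on ?_ ((integrableOn_const hfin).add (hiB.const_mul _))
      hB.measurableSet fun x hx => ?_
    · refine (hu.isC1Test.integrableOn_rpow (by linarith : 0 < p)).integrableOn.congr_fun
        (fun x _ => by simp [abs_of_nonneg (hu0 x)]) hB.measurableSet
    · refine (h _ (hu0 x)).trans ?_
      rw [abs_of_nonneg (hu0 x)]
      have h2 := hmW x (subset_closure hx)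
      have h3 : 0 ≤ u x ^ q := Real.rpow_nonneg (hu0 x) q
      have : C * u x ^ q ≤ C / m * (W x * u x ^ q) := by
        rw [div_mul_eq_mul_div, le_div_iff₀ hm]
        nlinarith [mul_nonneg (mul_nonneg hC.le h3) (sub_nonneg.2 h2)]
      linarith
  have hcB : Integrable (fun _ => 1 / (2 * (volume.real B + 1))) (volume.restrict B) :=
    integrableOn_const hfin
  rw [h1, integral_add hcB (hiB.const_mul _), integral_const_mul,
    setIntegral_const, smul_eq_mul] at key
  have h4 : volume.real B * (1 / (2 * (volume.real B + 1))) ≤ 1 / 2 := by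
    have : 0 ≤ volume.real B := measureReal_nonneg
    rw [mul_one_div, div_le_div_iff₀ (by positivity) (by positivity)]
    linarith
  have h5 : (∫ x in B, W x * |u x| ^ q) ≤ ∫ x in Ω, W x * |u x| ^ q := by
    refine setIntegral_mono_set hi ?_ (subset_closure.trans hBΩ).eventuallyLE
    filter_upwards [ae_restrict_mem hΩ.measurableSet] with x hx
    have := hWpos x hx
    positivity
  have h6 : 1 / 2 ≤ C / m * ∫ x in Ω, W x * |u x| ^ q :=
    le_trans (by linarith) (mul_le_mul_of_nonneg_left h5 (by positivity))
  rw [div_mul_eq_mul_div, le_div_iff₀ hm] at h6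
  rw [div_le_iff₀ (by positivity)]
  linarith

end Potentials

section Energy

variable {d : ℕ} {Ω : Set (EuclideanSpace ℝ (Fin d))}

/-- The `p`-energy `∫_Ω |∇u|^p + U|u|^p`. -/
def energy (Ω : Set (EuclideanSpace ℝ (Fin d))) (U : EuclideanSpace ℝ (Fin d) → ℝ) (p : ℝ)
    (u : EuclideanSpace ℝ (Fin d) → ℝ) : ℝ :=
  ∫ x in Ω, (‖gradient u x‖ ^ p + U x * |u x| ^ p)

/-- Measurable and locally bounded potentials. -/
structure IsLocBddPotential (Ω : Set (EuclideanSpace ℝ (Fin d)))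
    (U : EuclideanSpace ℝ (Fin d) → ℝ) : Prop where
  bdd : LocBddOn Ω U
  meas : AEStronglyMeasurable U (volume.restrict Ω)

lemma IsLocBddPotential.add_const_mul {U V : EuclideanSpace ℝ (Fin d) → ℝ}
    (hU : IsLocBddPotential Ω U) (hV : IsLocBddPotential Ω V) (c : ℝ) :
    IsLocBddPotential Ω (fun x => U x + c * V x) := by
  refine ⟨fun x hx => ?_, hU.meas.add (hV.meas.const_mul c)⟩
  obtain ⟨s, hs, C, hC⟩ := hU.bdd x hx
  obtain ⟨t, ht, D, hD⟩ := hV.bdd x hx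
  refine ⟨s ∩ t, inter_mem hs ht, C + |c| * D, fun y hy => (abs_add_le _ _).trans ?_⟩
  rw [abs_mul]
  exact add_le_add (hC y hy.1) (mul_le_mul_of_nonneg_left (hD y hy.2) (abs_nonneg c))

lemma IsLocBddPotential.integrableOn {U u : EuclideanSpace ℝ (Fin d) → ℝ} {p : ℝ}
    (hU : IsLocBddPotential Ω U) (hp : 0 < p) (hu : IsC1Test Ω u) :
    IntegrableOn (fun x => U x * |u x| ^ p) Ω :=
  hU.bdd.integrableOn_mul hU.meas (hu.integrableOn_rpow hp).integrableOn hu.compact hu.subset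
    fun x hx => by simp [image_eq_zero_of_notMem_tsupport hx, hp.ne']

lemma IsLocBddPotential.integrableOn_energy {U u : EuclideanSpace ℝ (Fin d) → ℝ} {p : ℝ}
    (hU : IsLocBddPotential Ω U) (hp : 0 < p) (hu : IsC1Test Ω u) :
    IntegrableOn (fun x => ‖gradient u x‖ ^ p + U x * |u x| ^ p) Ω :=
  (hu.integrable_gradient_rpow hp).integrableOn.add (hU.integrableOn hp hu)

lemma Qpert_eq_energy {V Vt : EuclideanSpace ℝ (Fin d) → ℝ} {p : ℝ} (hp : 0 < p)
    (hV : IsLocBddPotential Ω V) (hVt : IsLocBddPotential Ω Vt) (lam : ℝ)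
    {u : EuclideanSpace ℝ (Fin d) → ℝ} (hu : IsC1Test Ω u) :
    p * Qpert Ω V Vt p lam u = energy Ω (fun x => V x + p * lam * Vt x) p u := by
  have h1 : energy Ω (fun x => V x + p * lam * Vt x) p u =
      ∫ x in Ω, ((‖gradient u x‖ ^ p + V x * |u x| ^ p) + p * lam * (Vt x * |u x| ^ p)) := by
    refine integral_congr_ae (Eventually.of_forall fun x => ?_)
    simp only
    ring
  rw [h1, integral_add (hV.integrableOn_energy hp hu) ((hVt.integrableOn hp hu).const_mul _),
    integral_const_mul, Qpert, Qfun]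
  field_simp

lemma IsC1Test.exists_bound {u : EuclideanSpace ℝ (Fin d) → ℝ} (hu : IsC1Test Ω u) :
    ∃ M, 0 ≤ M ∧ (∀ x, |u x| ≤ M) ∧ ∀ x, ‖gradient u x‖ ≤ M := by
  obtain ⟨M₁, h₁⟩ := hu.contDiff.continuous.bounded_above_of_compact_support hu.compact
  obtain ⟨M₂, h₂⟩ := hu.contDiff.continuous_gradient.bounded_above_of_compact_support
    (hu.compact.mono' fun x hx => by_contra fun h => hx (gradient_eq_zero_of_notMem_tsupport h))
  exact ⟨max M₁ M₂, (norm_nonneg _).trans ((h₁ 0).trans (le_max_left _ _)),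
    fun x => (h₁ x).trans (le_max_left _ _), fun x => (h₂ x).trans (le_max_right _ _)⟩

/-- Nonnegativity of the energy passes from smooth to continuously differentiable functions. -/
lemma energy_nonneg_of_isC1Test (hΩ : IsOpen Ω) {U : EuclideanSpace ℝ (Fin d) → ℝ} {p : ℝ}
    (hp : 0 < p) (hU : IsLocBddPotential Ω U) (h : ∀ u, IsTestFun Ω u → 0 ≤ energy Ω U p u)
    {u : EuclideanSpace ℝ (Fin d) → ℝ} (hu : IsC1Test Ω u) : 0 ≤ energy Ω U p u := by
  obtain ⟨K, hK, hKΩ, huK, happ⟩ := hu.exists_approx hΩ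
  choose w hw hwK hw1 hw2 using fun n : ℕ => happ (1 / ((n : ℝ) + 1)) (by positivity)
  obtain ⟨M, hM0, hM1, hM2⟩ := hu.exists_bound
  obtain ⟨C, hC0, hC⟩ := hU.bdd.exists_bound hK hKΩ
  have hle1 : ∀ n : ℕ, 1 / ((n : ℝ) + 1) ≤ 1 := fun n => by
    rw [div_le_one (by positivity)]
    linarith [Nat.cast_nonneg (α := ℝ) n]
  have hw3 : ∀ n x, |w n x| ≤ M + 1 := fun n x => by
    have := abs_sub_abs_le_abs_sub (w n x) (u x)
    linarith [hw1 n x, hM1 x, hle1 n]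
  have hw4 : ∀ n x, ‖gradient (w n) x‖ ≤ M + 1 := fun n x => by
    have := norm_sub_norm_le (gradient (w n) x) (gradient u x)
    linarith [hw2 n x, hM2 x, hle1 n]
  have hlim : Tendsto (fun n => energy Ω U p (w n)) atTop (𝓝 (energy Ω U p u)) := by
    refine tendsto_integral_of_dominated_convergence
      (K.indicator fun _ => (M + 1) ^ p + C * (M + 1) ^ p)
      (fun n => (hU.integrableOn_energy hp (hw n).isC1Test).aestronglyMeasurable) ?_
      (fun n => Eventually.of_forall fun x => ?_) (Eventually.of_forall fun x => ?_)
    · exact ((integrable_indicator_iff hK.measurableSet).2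
        (integrableOn_const hK.measure_lt_top.ne)).restrict
    · by_cases hx : x ∈ K
      · rw [Set.indicator_of_mem hx]
        refine (norm_add_le _ _).trans (add_le_add ?_ ?_)
        · rw [Real.norm_of_nonneg (by positivity)]
          exact Real.rpow_le_rpow (norm_nonneg _) (hw4 n x) hp.le
        · rw [norm_mul, Real.norm_of_nonneg (by positivity : 0 ≤ |w n x| ^ p)]
          exact mul_le_mul (hC x hx) (Real.rpow_le_rpow (abs_nonneg _) (hw3 n x) hp.le)
            (by positivity) hC0
      · have hx' : x ∉ tsupport (w n) := fun h => hx (hwK n h)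
        simp [Set.indicator_of_notMem hx, image_eq_zero_of_notMem_tsupport hx',
          gradient_eq_zero_of_notMem_tsupport hx', hp.ne']
    · have t0 : Tendsto (fun n : ℕ => 1 / ((n : ℝ) + 1)) atTop (𝓝 0) :=
        tendsto_one_div_add_atTop_nhds_zero_nat
      have t1 : Tendsto (fun n => w n x) atTop (𝓝 (u x)) :=
        tendsto_iff_dist_tendsto_zero.2 (squeeze_zero (fun _ => dist_nonneg) (fun n => hw1 n x) t0)
      have t2 : Tendsto (fun n => gradient (w n) x) atTop (𝓝 (gradient u x)) :=
        tendsto_iff_dist_tendsto_zero.2 (squeeze_zero (fun _ => dist_nonneg)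
          (fun n => by rw [dist_eq_norm]; exact hw2 n x) t0)
      exact (t2.norm.rpow_const (Or.inr hp.le)).add
        ((t1.abs.rpow_const (Or.inr hp.le)).const_mul _)
  exact ge_of_tendsto' hlim fun n => h _ (hw n)

section Convergence

variable {α : Type*} [MeasurableSpace α] {μ : Measure α}

lemma tendsto_integral_rpow_of_lt [IsFiniteMeasure μ] {f : ℕ → α → ℝ} {a b : ℝ} (ha : 0 < a) (hab : a < b)
    (hf0 : ∀ n x, 0 ≤ f n x) (hfb : ∀ n, Integrable (fun x => f n x ^ b) μ)
    (h : Tendsto (fun n => ∫ x, f n x ^ b ∂μ) atTop (𝓝 0)) :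
    Tendsto (fun n => ∫ x, f n x ^ a ∂μ) atTop (𝓝 0) := by
  rw [Metric.tendsto_atTop] at h ⊢
  intro ε hε
  set m := μ.real Set.univ
  have hm : 0 ≤ m := measureReal_nonneg
  have hs : 0 < ε / (2 * (m + 1)) := by positivity
  obtain ⟨C, hC, hC'⟩ := exists_rpow_le_add_mul_rpow ha hab hs
  obtain ⟨N, hN⟩ := h (ε / (2 * C)) (by positivity)
  refine ⟨N, fun n hn => ?_⟩
  have h1 := hN n hn
  rw [Real.dist_eq, sub_zero, abs_of_nonneg (integral_nonneg fun x => Real.rpow_nonneg (hf0 n x) b),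
    lt_div_iff₀ (by positivity)] at h1
  rw [Real.dist_eq, sub_zero, abs_of_nonneg (integral_nonneg fun x => Real.rpow_nonneg (hf0 n x) a)]
  have h2 : ∫ x, f n x ^ a ∂μ ≤ ∫ x, (ε / (2 * (m + 1)) + C * f n x ^ b) ∂μ := by
    refine integral_mono_of_nonneg (Eventually.of_forall fun x => Real.rpow_nonneg (hf0 n x) a)
      ((integrable_const _).add ((hfb n).const_mul C)) (Eventually.of_forall fun x =>
        hC' _ (hf0 n x))
  rw [integral_add (integrable_const _) ((hfb n).const_mul C), integral_const_mul, integral_const,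
    smul_eq_mul] at h2
  have h3 : m * (ε / (2 * (m + 1))) < ε / 2 := by
    rw [mul_div_assoc', div_lt_div_iff₀ (by positivity) (by positivity)]
    nlinarith
  linarith

lemma tendsto_integral_mul_abs_rpow {p : ℝ} (hp : 1 < p) {a : ℕ → α → ℝ} {b U : α → ℝ} {M : ℝ}
    (ha : ∀ n, Integrable (fun x => |a n x| ^ p) μ) (hb : Integrable (fun x => |b x| ^ p) μ)
    (hab : ∀ n, Integrable (fun x => |a n x - b x| ^ p) μ)
    (hU : AEStronglyMeasurable U μ) (hUM : ∀ᵐ x ∂μ, |U x| ≤ M)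
    (h : Tendsto (fun n => ∫ x, |a n x - b x| ^ p ∂μ) atTop (𝓝 0)) :
    Tendsto (fun n => ∫ x, U x * |a n x| ^ p ∂μ) atTop (𝓝 (∫ x, U x * |b x| ^ p ∂μ)) := by
  have hi : ∀ f : α → ℝ, Integrable f μ → Integrable (fun x => U x * f x) μ := fun f hf =>
    hf.bdd_mul hU hUM
  rw [Metric.tendsto_atTop] at h ⊢
  intro ε hε
  set I := ∫ x, |b x| ^ p ∂μ
  have hI : 0 ≤ I := integral_nonneg fun x => by positivity
  set L := |M| + 1
  have hL : 0 < L := by positivity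
  obtain ⟨C, hC, hC'⟩ := exists_abs_rpow_sub_rpow_le hp (ε := ε / (2 * L * (I + 1)))
    (by positivity)
  obtain ⟨N, hN⟩ := h (ε / (2 * L * C)) (by positivity)
  refine ⟨N, fun n hn => ?_⟩
  have h1 := hN n hn
  rw [Real.dist_eq, sub_zero, abs_of_nonneg (integral_nonneg fun x => by positivity),
    lt_div_iff₀ (by positivity)] at h1
  rw [Real.dist_eq, ← integral_sub (hi _ (ha n)) (hi _ hb)]
  have h2 : |∫ x, (U x * |a n x| ^ p - U x * |b x| ^ p) ∂μ| ≤
      ∫ x, (L * (ε / (2 * L * (I + 1))) * |b x| ^ p + L * C * |a n x - b x| ^ p) ∂μ := by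
    rw [← Real.norm_eq_abs]
    refine norm_integral_le_of_norm_le ((hb.const_mul _).add ((hab n).const_mul _)) ?_
    filter_upwards [hUM] with x hx
    have h4 : |U x| ≤ L := hx.trans ((le_abs_self M).trans (by linarith))
    rw [← mul_sub, norm_mul, Real.norm_eq_abs, Real.norm_eq_abs]
    refine le_of_le_of_eq (b := L * (ε / (2 * L * (I + 1)) * |b x| ^ p + C * |a n x - b x| ^ p))
      ?_ (by ring)
    exact mul_le_mul h4 (hC' _ _) (abs_nonneg _) hL.le
  rw [integral_add (hb.const_mul _) ((hab n).const_mul _), integral_const_mul,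
    integral_const_mul] at h2
  have h3 : L * (ε / (2 * L * (I + 1))) * I < ε / 2 := by
    have : L * (ε / (2 * L * (I + 1))) * I = ε * I / (2 * (I + 1)) := by field_simp
    rw [this, div_lt_div_iff₀ (by positivity) (by positivity)]
    nlinarith
  have h5 : L * C * ∫ x, |a n x - b x| ^ p ∂μ < ε / 2 := by nlinarith
  linarith

end Convergence

end Energy

section EnergyComparison

variable {d : ℕ} {Ω : Set (EuclideanSpace ℝ (Fin d))}

lemma tendsto_integral_mul_fderiv {f : EuclideanSpace ℝ (Fin d) → ℝ} (hf : IsC1Test Ω f)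
    {K : Set (EuclideanSpace ℝ (Fin d))} (hK : IsCompact K) (hfK : tsupport f ⊆ K)
    {w : ℕ → EuclideanSpace ℝ (Fin d) → ℝ} (hw : ∀ n, ContDiff ℝ 1 (w n))
    (h : Tendsto (fun n => ∫ x in K, |w n x|) atTop (𝓝 0)) (e : EuclideanSpace ℝ (Fin d)) :
    Tendsto (fun n => ∫ x, f x * fderiv ℝ (w n) x e) atTop (𝓝 0) := by
  obtain ⟨M, hM0, -, hM⟩ := hf.exists_bound
  have hcf : Continuous fun x => fderiv ℝ f x e :=
    (hf.contDiff.continuous_fderiv one_ne_zero).clm_apply continuous_const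
  have hzero : ∀ x ∉ K, fderiv ℝ f x e = 0 := fun x hx => by
    rw [← inner_gradient_left, gradient_eq_zero_of_notMem_tsupport fun h => hx (hfK h),
      inner_zero_left]
  have hcs : HasCompactSupport fun x => fderiv ℝ f x e := HasCompactSupport.intro hK hzero
  refine squeeze_zero_norm (fun n => ?_) (by simpa using h.const_mul (M * ‖e‖))
  have hcw : Continuous fun x => fderiv ℝ (w n) x e :=
    ((hw n).continuous_fderiv one_ne_zero).clm_apply continuous_const
  rw [integral_mul_fderiv_eq_neg_fderiv_mul_of_integrable
    ((hcf.mul (hw n).continuous).integrable_of_hasCompactSupport hcs.mul_right)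
    ((hf.contDiff.continuous.mul hcw).integrable_of_hasCompactSupport hf.compact.mul_right)
    ((hf.contDiff.continuous.mul (hw n).continuous).integrable_of_hasCompactSupport
      hf.compact.mul_right)
    (fun x _ => hf.contDiff.differentiable one_ne_zero x)
    (fun x _ => (hw n).differentiable one_ne_zero x), norm_neg,
    ← setIntegral_eq_integral_of_forall_compl_eq_zero (s := K)
      (fun x hx => by rw [hzero x hx, zero_mul]), ← integral_const_mul]
  refine norm_integral_le_of_norm_le
    (((hw n).continuous.abs.const_mul _).continuousOn.integrableOn_compact hK)
    (Eventually.of_forall fun x => ?_)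
  rw [norm_mul]
  refine mul_le_mul_of_nonneg_right (((fderiv ℝ f x).le_opNorm e).trans ?_) (norm_nonneg _)
  rw [← norm_gradient]
  exact mul_le_mul_of_nonneg_right (hM x) (norm_nonneg _)

lemma tendsto_integral_mul_inner_gradient
    {H : EuclideanSpace ℝ (Fin d) → EuclideanSpace ℝ (Fin d)} (hH : ContDiff ℝ 1 H)
    {η : EuclideanSpace ℝ (Fin d) → ℝ} (hη : IsC1Test Ω η)
    {K : Set (EuclideanSpace ℝ (Fin d))} (hK : IsCompact K) (hηK : tsupport η ⊆ K)
    {w : ℕ → EuclideanSpace ℝ (Fin d) → ℝ} (hw : ∀ n, ContDiff ℝ 1 (w n))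
    (h : Tendsto (fun n => ∫ x in K, |w n x|) atTop (𝓝 0)) :
    Tendsto (fun n => ∫ x, η x * ⟪H x, gradient (w n) x⟫) atTop (𝓝 0) := by
  set b := stdOrthonormalBasis ℝ (EuclideanSpace ℝ (Fin d))
  have hf : ∀ i, IsC1Test Ω (fun x => ⟪H x, b i⟫ * η x) := fun i =>
    hη.mul_right (hH.inner ℝ contDiff_const)
  have hint : ∀ n i, Integrable (fun x => (⟪H x, b i⟫ * η x) * fderiv ℝ (w n) x (b i)) :=
    fun n i => ((hf i).contDiff.continuous.mul (((hw n).continuous_fderiv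
      one_ne_zero).clm_apply continuous_const)).integrable_of_hasCompactSupport
        (hf i).compact.mul_right
  have heq : ∀ n, ∫ x, η x * ⟪H x, gradient (w n) x⟫ =
      ∑ i, ∫ x, (⟪H x, b i⟫ * η x) * fderiv ℝ (w n) x (b i) := by
    intro n
    rw [← integral_finsetSum _ fun i _ => hint n i]
    refine integral_congr_ae (Eventually.of_forall fun x => ?_)
    simp only
    rw [← b.sum_inner_mul_inner (H x) (gradient (w n) x), Finset.mul_sum]
    refine Finset.sum_congr rfl fun i _ => ?_
    rw [real_inner_comm (gradient (w n) x) (b i), inner_gradient_left]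
    ring
  simp_rw [heq]
  rw [show (0 : ℝ) = ∑ i : Fin (Module.finrank ℝ (EuclideanSpace ℝ (Fin d))), (0 : ℝ) by simp]
  exact tendsto_finsetSum _ fun i _ => tendsto_integral_mul_fderiv (hf i) hK
    (tsupport_mul_subset_right.trans hηK) hw h (b i)

lemma energy_comparison {U : EuclideanSpace ℝ (Fin d) → ℝ} (hΩ : IsOpen Ω) {p : ℝ}
    (hp : 1 < p) (hU : IsLocBddPotential Ω U) (hpos : ∀ u, IsC1Test Ω u → 0 ≤ energy Ω U p u)
    {u : ℕ → EuclideanSpace ℝ (Fin d) → ℝ} (hu : ∀ n, IsC1Test Ω (u n))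
    (hlim : Tendsto (fun n => energy Ω U p (u n)) atTop (𝓝 0))
    {z φ ζ : EuclideanSpace ℝ (Fin d) → ℝ} (hz : IsC1Test Ω z) (hφ : IsC1Test Ω φ)
    (hζ : IsC1Test Ω ζ) (hζ0 : ∀ x, 0 ≤ ζ x) (hζ1 : ∀ x, ζ x ≤ 1)
    (hζφ : ∀ x ∈ tsupport φ, ζ x = 1)
    (hconv : Tendsto (fun n => ∫ x in tsupport ζ, |u n x - z x| ^ p) atTop (𝓝 0))
    {N : ℕ} (hN : p ≤ N)
    {H : EuclideanSpace ℝ (Fin d) → EuclideanSpace ℝ (Fin d)} (hH : ContDiff ℝ 1 H)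
    {ε : ℝ} (hε : 0 < ε) :
    0 ≤ (∫ x in tsupport ζ, ζ x ^ N * ((p - 1) * ‖H x‖ ^ (p / (p - 1)) - p * ⟪H x, gradient z x⟫
        + (1 + ε) * ‖gradient z x + gradient φ x‖ ^ p))
      + ((∫ x in tsupport ζ, U x * |z x + φ x| ^ p) - ∫ x in tsupport ζ, U x * |z x| ^ p) := by
  have hp0 : 0 < p := by linarith
  have hp1 : 0 < p - 1 := by linarith
  have hN1 : 1 < N := by exact_mod_cast hp.trans_le hN
  have hN0 : N ≠ 0 := by omega
  have hN0' : N - 1 ≠ 0 := by omega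
  set K := tsupport ζ with hKdef
  have hK : IsCompact K := hζ.compact
  have hi : ∀ f : EuclideanSpace ℝ (Fin d) → ℝ, Continuous f → IntegrableOn f K :=
    fun f hf => hf.continuousOn.integrableOn_compact hK
  have hUK : ∀ f : EuclideanSpace ℝ (Fin d) → ℝ, Continuous f → IntegrableOn (fun x => U x * f x) K := by
    intro f hf
    obtain ⟨C, -, hC⟩ := hU.bdd.exists_bound hK hζ.subset
    refine (hi f hf).bdd_mul (c := C) (hU.meas.mono_measure (Measure.restrict_mono hζ.subset le_rfl)) ?_
    filter_upwards [ae_restrict_mem hK.measurableSet] with x hx using hC x hx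
  obtain ⟨CU, -, hCU⟩ := hU.bdd.exists_bound hK hζ.subset
  obtain ⟨M, hM0, -, hM⟩ := hζ.exists_bound
  obtain ⟨C, hC0, hC⟩ := exists_norm_cutoff_combination_rpow_le
    (F := EuclideanSpace ℝ (Fin d)) hp hε hN
  have hη : IsC1Test Ω (fun x => ζ x ^ N) := by
    have : (fun x => ζ x ^ N) = fun x => ζ x ^ (N - 1) * ζ x := by
      ext x
      rw [← pow_succ, Nat.sub_add_cancel hN1.le]
    rw [this]
    exact hζ.mul_right (hζ.contDiff.pow _)
  have hηK : tsupport (fun x => ζ x ^ N) ⊆ K :=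
    closure_mono fun x hx h => hx (by simp [h, hN0])
  have hφK : tsupport φ ⊆ K := fun x hx => subset_tsupport _ (by simp [hζφ x hx])
  have hφ0 : ∀ x, (1 - ζ x ^ N) * φ x = 0 := fun x => by
    by_cases hx : x ∈ tsupport φ
    · simp [hζφ x hx]
    · simp [image_eq_zero_of_notMem_tsupport hx]
  have hgφ : ∀ x, gradient φ x = ζ x ^ N • gradient φ x := fun x => by
    by_cases hx : x ∈ tsupport φ
    · simp [hζφ x hx]
    · simp [gradient_eq_zero_of_notMem_tsupport hx]
  set m : ℕ → EuclideanSpace ℝ (Fin d) → ℝ :=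
    fun n x => (u n x + ζ x ^ N * (z x - u n x)) + φ x with hm
  have hmt : ∀ n, IsC1Test Ω (m n) := fun n =>
    ((hu n).add ((hz.sub (hu n)).mul_right hη.contDiff)).add hφ
  have hgm : ∀ n x, gradient (m n) x = (1 - ζ x ^ N) • gradient (u n) x
      + ζ x ^ N • (gradient z x + gradient φ x)
      + ζ x ^ (N - 1) • ((N * (z x - u n x)) • gradient ζ x) := by
    intro n x
    have h1 := (hζ.contDiff.hasGradientAt x).scomp (hasDerivAt_pow N (ζ x))
    have h2 := (((hu n).contDiff.hasGradientAt x).add' (h1.mul'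
      ((hz.contDiff.hasGradientAt x).sub' ((hu n).contDiff.hasGradientAt x)))).add'
      (hφ.contDiff.hasGradientAt x)
    rw [h2.gradient, smul_add, ← hgφ x]
    module
  have hoff : ∀ n, ∀ x ∉ K, ‖gradient (m n) x‖ ^ p + U x * |m n x| ^ p
      - (‖gradient (u n) x‖ ^ p + U x * |u n x| ^ p) = 0 := by
    intro n x hx
    have h1 : ζ x = 0 := image_eq_zero_of_notMem_tsupport hx
    have h2 : φ x = 0 := image_eq_zero_of_notMem_tsupport fun h => hx (hφK h)
    have h3 : gradient φ x = 0 := gradient_eq_zero_of_notMem_tsupport fun h => hx (hφK h)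
    rw [hgm]
    simp [hm, h1, h2, hN0, hN0']
  set Z : EuclideanSpace ℝ (Fin d) → ℝ := fun x => ζ x ^ N * ((p - 1) * ‖H x‖ ^ (p / (p - 1))
      + (1 + ε) * ‖gradient z x + gradient φ x‖ ^ p) with hZ
  have hcz := hz.contDiff.continuous_gradient
  have hcφ := hφ.contDiff.continuous_gradient
  have hcu := fun n => (hu n).contDiff.continuous_gradient
  have hcm := fun n => (hmt n).contDiff.continuous_gradient
  have hcζ := hζ.contDiff.continuous
  have hpp : 0 ≤ p / (p - 1) := by positivity
  have rpc : ∀ {f : EuclideanSpace ℝ (Fin d) → ℝ} {q : ℝ}, 0 ≤ q → Continuous f →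
      Continuous fun x => f x ^ q := fun hq hf => hf.rpow_const fun _ => Or.inr hq
  have hZc : Continuous Z := (hcζ.pow N).mul (((rpc hpp hH.continuous.norm).const_mul _).add
    ((rpc hp0.le (hcz.add hcφ).norm).const_mul _))
  have hmain : ∀ n, -energy Ω U p (u n) ≤ (∫ x in K, Z x)
      - p * (∫ x, ζ x ^ N * ⟪H x, gradient (u n) x⟫)
      + C * (N * M) ^ p * (∫ x in K, |u n x - z x| ^ p)
      + ((∫ x in K, U x * |m n x| ^ p) - ∫ x in K, U x * |u n x| ^ p) := by
    intro n
    have e1 : -energy Ω U p (u n) ≤ energy Ω U p (m n) - energy Ω U p (u n) := by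
      linarith [hpos _ (hmt n)]
    have e2 : energy Ω U p (m n) - energy Ω U p (u n) =
        ∫ x in K, (‖gradient (m n) x‖ ^ p + U x * |m n x| ^ p
          - (‖gradient (u n) x‖ ^ p + U x * |u n x| ^ p)) := by
      rw [energy, energy, ← integral_sub (hU.integrableOn_energy hp0 (hmt n))
        (hU.integrableOn_energy hp0 (hu n))]
      exact setIntegral_eq_of_subset_of_forall_sdiff_eq_zero hΩ.measurableSet hζ.subset
        fun x hx => hoff n x hx.2
    have i1 : IntegrableOn (fun x => ζ x ^ N * ⟪H x, gradient (u n) x⟫) K :=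
      hi _ ((hcζ.pow N).mul (hH.continuous.inner (hcu n)))
    have i2 : IntegrableOn (fun x => |u n x - z x| ^ p) K :=
      hi _ (rpc hp0.le ((hu n).contDiff.continuous.sub hz.contDiff.continuous).abs)
    have i3 : IntegrableOn (fun x => U x * |m n x| ^ p) K :=
      hUK _ (rpc hp0.le (hmt n).contDiff.continuous.abs)
    have i4 : IntegrableOn (fun x => U x * |u n x| ^ p) K :=
      hUK _ (rpc hp0.le (hu n).contDiff.continuous.abs)
    have e3 : ∫ x, ζ x ^ N * ⟪H x, gradient (u n) x⟫
        = ∫ x in K, ζ x ^ N * ⟪H x, gradient (u n) x⟫ := by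
      refine (setIntegral_eq_integral_of_forall_compl_eq_zero fun x hx => ?_).symm
      simp [image_eq_zero_of_notMem_tsupport hx, hN0]
    have i5 : IntegrableOn (fun x => Z x - p * (ζ x ^ N * ⟪H x, gradient (u n) x⟫)) K :=
      (hi _ hZc).sub (i1.const_mul p)
    have i6 : IntegrableOn (fun x => C * (N * M) ^ p * |u n x - z x| ^ p) K := i2.const_mul _
    have i7 : IntegrableOn (fun x => U x * |m n x| ^ p - U x * |u n x| ^ p) K := i3.sub i4
    have i8 : IntegrableOn (fun x => Z x - p * (ζ x ^ N * ⟪H x, gradient (u n) x⟫)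
        + C * (N * M) ^ p * |u n x - z x| ^ p) K := i5.add i6
    refine e1.trans ?_
    rw [e2, e3, ← integral_const_mul, ← integral_const_mul,
      ← integral_sub (hi _ hZc) (i1.const_mul p),
      ← integral_sub i3 i4, ← integral_add i5 i6,
      ← integral_add i8 i7]
    refine integral_mono (((hi _ (rpc hp0.le (hcm n).norm)).add i3).sub
        ((hi _ (rpc hp0.le (hcu n).norm)).add i4))
      (i8.add i7) fun x => ?_
    have f1 := hC (ζ x) (gradient (u n) x) (gradient z x + gradient φ x)
      ((N * (z x - u n x)) • gradient ζ x) (hζ0 x) (hζ1 x)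
    rw [← hgm] at f1
    have f2 : ‖(N * (z x - u n x)) • gradient ζ x‖ ^ p ≤ (N * M) ^ p * |u n x - z x| ^ p := by
      rw [← Real.mul_rpow (by positivity) (abs_nonneg _)]
      refine Real.rpow_le_rpow (norm_nonneg _) ?_ hp0.le
      rw [norm_smul, norm_mul, Real.norm_natCast, Real.norm_eq_abs, abs_sub_comm, mul_right_comm]
      exact mul_le_mul_of_nonneg_right (mul_le_mul_of_nonneg_left (hM x) (by positivity))
        (abs_nonneg _)
    have f3 := mul_inner_le_norm_rpow_add hp (H x) (gradient (u n) x)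
    have f4 : 0 ≤ ζ x ^ N := pow_nonneg (hζ0 x) N
    have f5 := mul_le_mul_of_nonneg_left f3 f4
    have f6 := mul_le_mul_of_nonneg_left f2 hC0.le
    simp only [hZ]
    linarith
  have hl1 : Tendsto (fun n => ∫ x in K, |u n x - z x|) atTop (𝓝 0) := by
    have : IsFiniteMeasure (volume.restrict K) := ⟨by simpa using hK.measure_lt_top⟩
    have := tendsto_integral_rpow_of_lt (μ := volume.restrict K)
      (f := fun n x => |u n x - z x|) one_pos hp (fun n x => abs_nonneg _)
      (fun n => hi _ (rpc hp0.le ((hu n).contDiff.continuous.sub hz.contDiff.continuous).abs)) hconv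
    simpa using this
  have hl2 : Tendsto (fun n => ∫ x, ζ x ^ N * ⟪H x, gradient (u n) x⟫) atTop
      (𝓝 (∫ x, ζ x ^ N * ⟪H x, gradient z x⟫)) := by
    have h1 := tendsto_integral_mul_inner_gradient hH hη hK hηK
      (fun n => (hu n).contDiff.sub hz.contDiff) hl1
    have h2 := h1.add_const (∫ x, ζ x ^ N * ⟪H x, gradient z x⟫)
    rw [zero_add] at h2
    refine h2.congr fun n => ?_
    have hint : ∀ f : EuclideanSpace ℝ (Fin d) → ℝ, ContDiff ℝ 1 f →
        Integrable fun x => ζ x ^ N * ⟪H x, gradient f x⟫ := fun f hf =>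
      ((hcζ.pow N).mul (hH.continuous.inner hf.continuous_gradient)).integrable_of_hasCompactSupport
        hη.compact.mul_right
    rw [← integral_add (hint _ ((hu n).contDiff.sub hz.contDiff)) (hint _ hz.contDiff)]
    refine integral_congr_ae (Eventually.of_forall fun x => ?_)
    have := (((hu n).contDiff.hasGradientAt x).sub' (hz.contDiff.hasGradientAt x)).gradient
    simp only
    rw [this, inner_sub_right]
    ring
  have hUM : ∀ᵐ x ∂(volume.restrict K), |U x| ≤ CU := by
    filter_upwards [ae_restrict_mem hK.measurableSet] with x hx using hCU x hx
  have hUm : AEStronglyMeasurable U (volume.restrict K) :=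
    hU.meas.mono_measure (Measure.restrict_mono hζ.subset le_rfl)
  have hl3 := tendsto_integral_mul_abs_rpow (μ := volume.restrict K) hp (a := u) (b := z)
    (fun n => hi _ (rpc hp0.le (hu n).contDiff.continuous.abs))
    (hi _ (rpc hp0.le hz.contDiff.continuous.abs))
    (fun n => hi _ (rpc hp0.le ((hu n).contDiff.continuous.sub hz.contDiff.continuous).abs))
    hUm hUM hconv
  have hl4 := tendsto_integral_mul_abs_rpow (μ := volume.restrict K) hp (a := m)
    (b := fun x => z x + φ x)
    (fun n => hi _ (rpc hp0.le (hmt n).contDiff.continuous.abs))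
    (hi _ (rpc hp0.le (hz.add hφ).contDiff.continuous.abs))
    (fun n => hi _ (rpc hp0.le ((hmt n).contDiff.continuous.sub (hz.add hφ).contDiff.continuous).abs))
    hUm hUM (by
      refine squeeze_zero (fun n => integral_nonneg fun x => by positivity) (fun n => ?_) hconv
      refine integral_mono
        (hi _ (rpc hp0.le ((hmt n).contDiff.continuous.sub (hz.add hφ).contDiff.continuous).abs))
        (hi _ (rpc hp0.le ((hu n).contDiff.continuous.sub hz.contDiff.continuous).abs)) fun x => ?_
      refine Real.rpow_le_rpow (abs_nonneg _) ?_ hp0.le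
      have : m n x - (z x + φ x) = (1 - ζ x ^ N) * (u n x - z x) := by
        simp only [hm]
        ring
      rw [this, abs_mul]
      refine mul_le_of_le_one_left (abs_nonneg _) ?_
      rw [abs_of_nonneg (sub_nonneg.2 (pow_le_one₀ (hζ0 x) (hζ1 x)))]
      linarith [pow_nonneg (hζ0 x) N])
  have hfin := le_of_tendsto_of_tendsto' hlim.neg
    ((((tendsto_const_nhds (x := ∫ x in K, Z x)).sub (hl2.const_mul p)).add
      (hconv.const_mul (C * (N * M) ^ p))).add (hl4.sub hl3)) hmain
  rw [neg_zero, mul_zero, add_zero] at hfin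
  refine hfin.trans_eq ?_
  congr 1
  have e3 : ∫ x, ζ x ^ N * ⟪H x, gradient z x⟫ = ∫ x in K, ζ x ^ N * ⟪H x, gradient z x⟫ := by
    refine (setIntegral_eq_integral_of_forall_compl_eq_zero fun x hx => ?_).symm
    simp [image_eq_zero_of_notMem_tsupport hx, hN0]
  have i1 : IntegrableOn (fun x => ζ x ^ N * ⟪H x, gradient z x⟫) K :=
    hi _ ((hcζ.pow N).mul (hH.continuous.inner hcz))
  rw [e3, ← integral_const_mul, ← integral_sub (hi _ hZc) (i1.const_mul p)]
  refine integral_congr_ae (Eventually.of_forall fun x => ?_)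
  simp only [hZ]
  ring

end EnergyComparison

section FirstVariation

variable {d : ℕ} {Ω : Set (EuclideanSpace ℝ (Fin d))}

lemma hasDerivAt_norm_add_smul_rpow {F : Type*} [NormedAddCommGroup F] [InnerProductSpace ℝ F]
    {p : ℝ} (hp : 1 < p) (X Y : F) (t : ℝ) :
    HasDerivAt (fun t : ℝ => ‖X + t • Y‖ ^ p) (p * ⟪dualityMap p (X + t • Y), Y⟫) t := by
  have h1 : HasDerivAt (fun t : ℝ => X + t • Y) Y t := by
    simpa using ((hasDerivAt_id t).smul_const Y).const_add X
  refine ((hasFDerivAt_norm_rpow (X + t • Y) hp).comp_hasDerivAt t h1).congr_deriv ?_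
  rw [dualityMap, real_inner_smul_left, ← mul_assoc]
  rfl

lemma energy_minimality {U : EuclideanSpace ℝ (Fin d) → ℝ} (hΩ : IsOpen Ω) {p : ℝ}
    (hp : 1 < p) (hU : IsLocBddPotential Ω U) (hpos : ∀ u, IsC1Test Ω u → 0 ≤ energy Ω U p u)
    {u : ℕ → EuclideanSpace ℝ (Fin d) → ℝ} (hu : ∀ n, IsC1Test Ω (u n))
    (hlim : Tendsto (fun n => energy Ω U p (u n)) atTop (𝓝 0))
    {z φ ζ : EuclideanSpace ℝ (Fin d) → ℝ} (hz : IsC1Test Ω z) (hφ : IsC1Test Ω φ)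
    (hζ : IsC1Test Ω ζ) (hζ0 : ∀ x, 0 ≤ ζ x) (hζ1 : ∀ x, ζ x ≤ 1)
    (hζφ : ∀ x ∈ tsupport φ, ζ x = 1)
    (hconv : Tendsto (fun n => ∫ x in tsupport ζ, |u n x - z x| ^ p) atTop (𝓝 0))
    {N : ℕ} (hN : p ≤ N) :
    (∫ x in tsupport ζ, ζ x ^ N * ‖gradient z x‖ ^ p) + ∫ x in tsupport ζ, U x * |z x| ^ p ≤
      (∫ x in tsupport ζ, ζ x ^ N * ‖gradient z x + gradient φ x‖ ^ p)
        + ∫ x in tsupport ζ, U x * |z x + φ x| ^ p := by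
  have hp0 : 0 < p := by linarith
  have hp1 : 0 < p - 1 := by linarith
  have hpp : 0 ≤ p / (p - 1) := by positivity
  set K := tsupport ζ with hKdef
  have hK : IsCompact K := hζ.compact
  have hi : ∀ f : EuclideanSpace ℝ (Fin d) → ℝ, Continuous f → IntegrableOn f K :=
    fun f hf => hf.continuousOn.integrableOn_compact hK
  have hcz := hz.contDiff.continuous_gradient
  have hcφ := hφ.contDiff.continuous_gradient
  have hcζ := hζ.contDiff.continuous
  have rpc : ∀ {f : EuclideanSpace ℝ (Fin d) → ℝ} {q : ℝ}, 0 ≤ q → Continuous f →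
      Continuous fun x => f x ^ q := fun hq hf => hf.rpow_const fun _ => Or.inr hq
  set D : EuclideanSpace ℝ (Fin d) → EuclideanSpace ℝ (Fin d) :=
    fun x => dualityMap p (gradient z x) with hD
  have hDc : Continuous D := (continuous_dualityMap hp).comp hcz
  have happ : ∀ n : ℕ, ∃ H : EuclideanSpace ℝ (Fin d) → EuclideanSpace ℝ (Fin d),
      ContDiff ℝ 1 H ∧ ∀ x, dist (H x) (D x) < 1 / ((n : ℝ) + 1) := fun n => by
    obtain ⟨H, h1, h2, -⟩ := hDc.exists_contDiff_approx (ε := fun _ => 1 / ((n : ℝ) + 1)) 1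
      continuous_const (fun _ => by positivity)
    exact ⟨H, by exact_mod_cast h1, h2⟩
  choose H hH hHD using happ
  have hle1 : ∀ n : ℕ, 1 / ((n : ℝ) + 1) ≤ 1 := fun n => by
    rw [div_le_one (by positivity)]
    linarith [Nat.cast_nonneg (α := ℝ) n]
  have t0 : Tendsto (fun n : ℕ => 1 / ((n : ℝ) + 1)) atTop (𝓝 0) :=
    tendsto_one_div_add_atTop_nhds_zero_nat
  have hHb : ∀ n x, ‖H n x‖ ≤ ‖D x‖ + 1 := fun n x => by
    have := norm_sub_norm_le (H n x) (D x)
    have h2 := hHD n x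
    rw [dist_eq_norm] at h2
    linarith [hle1 n]
  have key := fun n : ℕ => energy_comparison hΩ hp hU hpos hu hlim hz hφ hζ hζ0 hζ1 hζφ hconv hN
    (hH n) (ε := 1 / ((n : ℝ) + 1)) (by positivity)
  have hl : Tendsto (fun n : ℕ => ∫ x in K, ζ x ^ N * ((p - 1) * ‖H n x‖ ^ (p / (p - 1))
      - p * ⟪H n x, gradient z x⟫ + (1 + 1 / ((n : ℝ) + 1)) * ‖gradient z x + gradient φ x‖ ^ p))
      atTop (𝓝 (∫ x in K, ζ x ^ N * ((p - 1) * ‖D x‖ ^ (p / (p - 1))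
      - p * ⟪D x, gradient z x⟫ + (1 + 0) * ‖gradient z x + gradient φ x‖ ^ p))) := by
    refine tendsto_integral_of_dominated_convergence
      (fun x => (p - 1) * (‖D x‖ + 1) ^ (p / (p - 1)) + p * ((‖D x‖ + 1) * ‖gradient z x‖)
        + 2 * ‖gradient z x + gradient φ x‖ ^ p) (fun n => ?_) ?_
      (fun n => Eventually.of_forall fun x => ?_) (Eventually.of_forall fun x => ?_)
    · exact ((hcζ.pow N).mul ((((rpc hpp (hH n).continuous.norm).const_mul _).sub
        (((hH n).continuous.inner hcz).const_mul p)).add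
        ((rpc hp0.le (hcz.add hcφ).norm).const_mul _))).aestronglyMeasurable
    · exact hi _ ((((rpc hpp (hDc.norm.add continuous_const)).const_mul _).add
        (((hDc.norm.add continuous_const).mul hcz.norm).const_mul p)).add
        ((rpc hp0.le (hcz.add hcφ).norm).const_mul _))
    · rw [norm_mul, Real.norm_of_nonneg (pow_nonneg (hζ0 x) N)]
      refine (mul_le_of_le_one_left (norm_nonneg _) (pow_le_one₀ (hζ0 x) (hζ1 x))).trans ?_
      refine (norm_add_le _ _).trans (add_le_add ((norm_sub_le _ _).trans (add_le_add ?_ ?_)) ?_)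
      · rw [Real.norm_of_nonneg (by positivity)]
        exact mul_le_mul_of_nonneg_left (Real.rpow_le_rpow (norm_nonneg _) (hHb n x) hpp) hp1.le
      · rw [norm_mul, Real.norm_of_nonneg hp0.le]
        refine mul_le_mul_of_nonneg_left ((norm_inner_le_norm _ _).trans ?_) hp0.le
        exact mul_le_mul_of_nonneg_right (hHb n x) (norm_nonneg _)
      · rw [Real.norm_of_nonneg (by positivity)]
        exact mul_le_mul_of_nonneg_right (by linarith [hle1 n]) (by positivity)
    · have hHx : Tendsto (fun n => H n x) atTop (𝓝 (D x)) :=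
        tendsto_iff_dist_tendsto_zero.2 (squeeze_zero (fun _ => dist_nonneg)
          (fun n => (hHD n x).le) t0)
      exact ((((hHx.norm.rpow_const (Or.inr hpp)).const_mul _).sub
        ((hHx.inner tendsto_const_nhds).const_mul _)).add
        ((t0.const_add 1).mul_const _)).const_mul _
  have h1 := ge_of_tendsto' (hl.add_const _) key
  have h2 : ∫ x in K, ζ x ^ N * ((p - 1) * ‖D x‖ ^ (p / (p - 1))
      - p * ⟪D x, gradient z x⟫ + (1 + 0) * ‖gradient z x + gradient φ x‖ ^ p)
      = (∫ x in K, ζ x ^ N * ‖gradient z x + gradient φ x‖ ^ p)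
        - ∫ x in K, ζ x ^ N * ‖gradient z x‖ ^ p := by
    have i1 : IntegrableOn (fun x => ζ x ^ N * ‖gradient z x + gradient φ x‖ ^ p) K :=
      hi _ ((hcζ.pow N).mul (rpc hp0.le (hcz.add hcφ).norm))
    have i2 : IntegrableOn (fun x => ζ x ^ N * ‖gradient z x‖ ^ p) K :=
      hi _ ((hcζ.pow N).mul (rpc hp0.le hcz.norm))
    rw [← integral_sub i1 i2]
    refine integral_congr_ae (Eventually.of_forall fun x => ?_)
    simp only [hD]
    rw [norm_dualityMap_rpow hp, inner_dualityMap_self hp]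
    ring
  rw [h2] at h1
  linarith

/-- The Euler–Lagrange equation satisfied by limits of null sequences. -/
lemma integral_first_variation_eq_zero {U : EuclideanSpace ℝ (Fin d) → ℝ} (hΩ : IsOpen Ω) {p : ℝ}
    (hp : 1 < p) (hU : IsLocBddPotential Ω U) (hpos : ∀ u, IsC1Test Ω u → 0 ≤ energy Ω U p u)
    {u : ℕ → EuclideanSpace ℝ (Fin d) → ℝ} (hu : ∀ n, IsC1Test Ω (u n))
    (hlim : Tendsto (fun n => energy Ω U p (u n)) atTop (𝓝 0))
    {z φ ζ : EuclideanSpace ℝ (Fin d) → ℝ} (hz : IsC1Test Ω z) (hφ : IsC1Test Ω φ)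
    (hζ : IsC1Test Ω ζ) (hζ0 : ∀ x, 0 ≤ ζ x) (hζ1 : ∀ x, ζ x ≤ 1)
    (hζφ : ∀ x ∈ tsupport φ, ζ x = 1)
    (hconv : Tendsto (fun n => ∫ x in tsupport ζ, |u n x - z x| ^ p) atTop (𝓝 0)) :
    ∫ x in Ω, (⟪dualityMap p (gradient z x), gradient φ x⟫
      + U x * (⟪dualityMap p (z x), φ x⟫)) = 0 := by
  have hp0 : 0 < p := by linarith
  have hp1 : 0 < p - 1 := by linarith
  obtain ⟨N, hN⟩ := exists_nat_ge p
  set K := tsupport ζ with hKdef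
  have hK : IsCompact K := hζ.compact
  have hi : ∀ f : EuclideanSpace ℝ (Fin d) → ℝ, Continuous f → IntegrableOn f K :=
    fun f hf => hf.continuousOn.integrableOn_compact hK
  obtain ⟨CU, hCU0, hCU⟩ := hU.bdd.exists_bound hK hζ.subset
  have hUm : AEStronglyMeasurable U (volume.restrict K) :=
    hU.meas.mono_measure (Measure.restrict_mono hζ.subset le_rfl)
  have hUM : ∀ᵐ x ∂(volume.restrict K), ‖U x‖ ≤ CU := by
    filter_upwards [ae_restrict_mem hK.measurableSet] with x hx using hCU x hx
  have hUK : ∀ f : EuclideanSpace ℝ (Fin d) → ℝ, Continuous f →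
      IntegrableOn (fun x => U x * f x) K := fun f hf => (hi f hf).bdd_mul hUm hUM
  have hφK : tsupport φ ⊆ K := fun x hx => subset_tsupport _ (by simp [hζφ x hx])
  have hcz := hz.contDiff.continuous_gradient
  have hcφ := hφ.contDiff.continuous_gradient
  have hcζ := hζ.contDiff.continuous
  have hcz0 := hz.contDiff.continuous
  have hcφ0 := hφ.contDiff.continuous
  have rpc : ∀ {f : EuclideanSpace ℝ (Fin d) → ℝ} {q : ℝ}, 0 ≤ q → Continuous f →
      Continuous fun x => f x ^ q := fun hq hf => hf.rpow_const fun _ => Or.inr hq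
  set G : ℝ → EuclideanSpace ℝ (Fin d) → ℝ := fun t x =>
    ζ x ^ N * ‖gradient z x + t • gradient φ x‖ ^ p + U x * ‖z x + t • φ x‖ ^ p with hG
  set G' : ℝ → EuclideanSpace ℝ (Fin d) → ℝ := fun t x =>
    ζ x ^ N * (p * ⟪dualityMap p (gradient z x + t • gradient φ x), gradient φ x⟫)
      + U x * (p * ⟪dualityMap p (z x + t • φ x), φ x⟫) with hG'
  have hGi1 : ∀ t : ℝ, IntegrableOn (fun x => ζ x ^ N * ‖gradient z x + t • gradient φ x‖ ^ p) K :=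
    fun t => hi _ ((hcζ.pow N).mul (rpc hp0.le (hcz.add (hcφ.const_smul t)).norm))
  have hGi2 : ∀ t : ℝ, IntegrableOn (fun x => U x * ‖z x + t • φ x‖ ^ p) K :=
    fun t => hUK _ (rpc hp0.le (hcz0.add (hcφ0.const_smul t)).norm)
  have hG'i : ∀ t : ℝ, IntegrableOn (G' t) K := fun t =>
    (hi _ ((hcζ.pow N).mul ((((continuous_dualityMap hp).comp
      (hcz.add (hcφ.const_smul t))).inner hcφ).const_mul p))).add
    (hUK _ ((((continuous_dualityMap hp).comp
      (hcz0.add (hcφ0.const_smul t))).inner hcφ0).const_mul p))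
  have hbound : ∀ {F : Type} [NormedAddCommGroup F] [InnerProductSpace ℝ F] (X Y : F) (t : ℝ),
      t ∈ Metric.ball (0 : ℝ) 1 →
      ‖p * ⟪dualityMap p (X + t • Y), Y⟫‖ ≤ p * ((‖X‖ + ‖Y‖) ^ (p - 1) * ‖Y‖) := by
    intro F _ _ X Y t ht
    rw [norm_mul, Real.norm_of_nonneg hp0.le]
    refine mul_le_mul_of_nonneg_left ((norm_inner_le_norm _ _).trans ?_) hp0.le
    refine mul_le_mul_of_nonneg_right ?_ (norm_nonneg _)
    rw [norm_dualityMap hp]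
    refine Real.rpow_le_rpow (norm_nonneg _) ((norm_add_le _ _).trans ?_) hp1.le
    have h1 : ‖t‖ ≤ 1 := by simpa using (mem_ball_zero_iff.1 ht).le
    rw [norm_smul]
    linarith [mul_le_of_le_one_left (norm_nonneg Y) h1]
  have hder := (hasDerivAt_integral_of_dominated_loc_of_deriv_le (μ := volume.restrict K)
    (F := G) (F' := G') (x₀ := 0) (s := Metric.ball (0 : ℝ) 1)
    (bound := fun x => p * ((‖gradient z x‖ + ‖gradient φ x‖) ^ (p - 1) * ‖gradient φ x‖)
      + CU * (p * ((‖z x‖ + ‖φ x‖) ^ (p - 1) * ‖φ x‖))) (Metric.ball_mem_nhds _ one_pos)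
    (Eventually.of_forall fun t => ((hGi1 t).add (hGi2 t)).aestronglyMeasurable)
    ((hGi1 0).add (hGi2 0)) (hG'i 0).aestronglyMeasurable (by
      filter_upwards [hUM] with x hx t ht
      refine (norm_add_le _ _).trans (add_le_add ?_ ?_)
      · rw [norm_mul, Real.norm_of_nonneg (pow_nonneg (hζ0 x) N)]
        exact (mul_le_of_le_one_left (norm_nonneg _) (pow_le_one₀ (hζ0 x) (hζ1 x))).trans
          (hbound _ _ t ht)
      · rw [norm_mul]
        exact mul_le_mul hx (hbound _ _ t ht) (norm_nonneg _) hCU0)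
    (hi _ (((((rpc hp1.le (hcz.norm.add hcφ.norm)).mul hcφ.norm).const_mul p)).add
      ((((rpc hp1.le (hcz0.norm.add hcφ0.norm)).mul hcφ0.norm).const_mul p).const_mul _)))
    (Eventually.of_forall fun x t _ =>
      ((hasDerivAt_norm_add_smul_rpow hp _ _ t).const_mul _).add
        ((hasDerivAt_norm_add_smul_rpow hp _ _ t).const_mul _))).2
  have hmin : IsLocalMin (fun t => ∫ x in K, G t x) 0 := by
    refine Eventually.of_forall fun t => ?_
    have h1 : IsC1Test Ω (fun x => t * φ x) := hφ.mul_right contDiff_const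
    have h2 : ∀ x, gradient (fun x => t * φ x) x = t • gradient φ x := fun x => by
      have := ((hφ.contDiff.hasGradientAt x).scomp ((hasDerivAt_id (φ x)).const_mul t)).gradient
      simpa using this
    have h3 := energy_minimality hΩ hp hU hpos hu hlim hz h1 hζ hζ0 hζ1
      (fun x hx => hζφ x (tsupport_mul_subset_right hx)) hconv hN
    simp only [h2] at h3
    simp only [hG]
    rw [integral_add (hGi1 0) (hGi2 0), integral_add (hGi1 t) (hGi2 t)]
    simpa using h3
  have h0 := hmin.hasDerivAt_eq_zero hder
  have hoff : ∀ x, x ∉ tsupport φ → ⟪dualityMap p (gradient z x), gradient φ x⟫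
      + U x * (⟪dualityMap p (z x), φ x⟫) = 0 := fun x hx => by
    rw [gradient_eq_zero_of_notMem_tsupport hx, image_eq_zero_of_notMem_tsupport hx]
    simp
  rw [setIntegral_eq_of_subset_of_forall_sdiff_eq_zero hΩ.measurableSet hζ.subset
    fun x hx => hoff x fun h => hx.2 (hφK h)]
  refine (mul_eq_zero.1 ?_).resolve_left hp0.ne'
  rw [← integral_const_mul, ← h0]
  refine integral_congr_ae (Eventually.of_forall fun x => ?_)
  simp only [hG', zero_smul, add_zero]
  by_cases hx : x ∈ tsupport φ
  · rw [hζφ x hx, one_pow]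
    ring
  · rw [hoff x hx, gradient_eq_zero_of_notMem_tsupport hx, image_eq_zero_of_notMem_tsupport hx]
    simp

end FirstVariation

section GroundState

variable {d : ℕ} {Ω : Set (EuclideanSpace ℝ (Fin d))}

lemma integrableOn_of_continuousOn_of_eq_zero (hΩ : IsOpen Ω) {f : EuclideanSpace ℝ (Fin d) → ℝ}
    (hf : ContinuousOn f Ω) {K : Set (EuclideanSpace ℝ (Fin d))} (hK : IsCompact K) (hKΩ : K ⊆ Ω)
    (hfK : ∀ x ∉ K, f x = 0) : IntegrableOn f Ω :=
  ((hf.mono hKΩ).integrableOn_compact hK).of_forall_sdiff_eq_zero hΩ.measurableSet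
    fun x hx => hfK x hx.2

lemma ContDiffOn.continuousOn_gradient (hΩ : IsOpen Ω) {v : EuclideanSpace ℝ (Fin d) → ℝ}
    (hv : ContDiffOn ℝ 1 v Ω) : ContinuousOn (gradient v) Ω :=
  (InnerProductSpace.toDual ℝ _).symm.continuous.comp_continuousOn
    (hv.continuousOn_fderiv_of_isOpen hΩ le_rfl)

/-- `v` is a positive `C¹` limit in `L^p_loc` of functions with vanishing energy. -/
structure IsEnergyGroundState (Ω : Set (EuclideanSpace ℝ (Fin d)))
    (U : EuclideanSpace ℝ (Fin d) → ℝ) (p : ℝ) (v : EuclideanSpace ℝ (Fin d) → ℝ) : Prop where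
  potential : IsLocBddPotential Ω U
  nonneg : ∀ u, IsC1Test Ω u → 0 ≤ energy Ω U p u
  pos : ∀ x ∈ Ω, 0 < v x
  contDiffOn : ContDiffOn ℝ 1 v Ω
  approx : ∃ u : ℕ → EuclideanSpace ℝ (Fin d) → ℝ, (∀ n, IsC1Test Ω (u n)) ∧
    Tendsto (fun n => energy Ω U p (u n)) atTop (𝓝 0) ∧
    ∀ K : Set (EuclideanSpace ℝ (Fin d)), K ⊆ Ω → IsCompact K →
      Tendsto (fun n => ∫ x in K, |u n x - v x| ^ p) atTop (𝓝 0)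

variable {U v : EuclideanSpace ℝ (Fin d) → ℝ} {p : ℝ}

lemma IsEnergyGroundState.integral_eq_zero (h : IsEnergyGroundState Ω U p v) (hΩ : IsOpen Ω)
    (hp : 1 < p) {φ : EuclideanSpace ℝ (Fin d) → ℝ} (hφ : IsC1Test Ω φ) :
    ∫ x in Ω, (⟪dualityMap p (gradient v x), gradient φ x⟫
      + U x * (⟪dualityMap p (v x), φ x⟫)) = 0 := by
  obtain ⟨u, hu, hlim, hconv⟩ := h.approx
  obtain ⟨ζ, hζ, hζ0, hζ1, hζφ⟩ := exists_isTestFun_one_nhds hΩ hφ.compact hφ.subset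
  obtain ⟨χ, hχ, -, -, hχζ⟩ := exists_isTestFun_one_nhds hΩ hζ.2.1 hζ.2.2
  have hz : IsC1Test Ω (fun x => χ x * v x) :=
    IsC1Test.of_contDiffOn hΩ (hχ.isC1Test.contDiff.contDiffOn.mul h.contDiffOn) hχ.isC1Test
      fun x hx => by simp [hx]
  have hzv : ∀ x ∈ tsupport ζ, (fun x => χ x * v x) =ᶠ[𝓝 x] v := fun x hx => by
    filter_upwards [hχζ x hx] with y hy
    simp [hy]
  have h1 := integral_first_variation_eq_zero hΩ hp h.potential h.nonneg hu hlim hz hφ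
    hζ.isC1Test hζ0 hζ1 (fun x hx => (hζφ x hx).self_of_nhds) (by
      refine (hconv _ hζ.2.2 hζ.2.1).congr fun n => ?_
      refine setIntegral_congr_fun (isClosed_tsupport _).measurableSet fun x hx => ?_
      simp only [(hzv x hx).eq_of_nhds])
  rw [← h1]
  refine integral_congr_ae (Eventually.of_forall fun x => ?_)
  by_cases hx : x ∈ tsupport φ
  · have hx' : x ∈ tsupport ζ := subset_tsupport _ (by simp [(hζφ x hx).self_of_nhds])
    simp only
    rw [(hzv x hx').gradient_eq, (hzv x hx').eq_of_nhds]
  · simp [gradient_eq_zero_of_notMem_tsupport hx, image_eq_zero_of_notMem_tsupport hx]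

lemma hasDerivAt_abs_rpow_mul (hp : 1 < p) (t : ℝ) :
    HasDerivAt (fun t : ℝ => |t| ^ p) (p * (|t| ^ (p - 2) * t)) t := by
  have := hasDerivAt_norm_add_smul_rpow hp (0 : ℝ) 1 t
  simpa [dualityMap] using this

/-- Test function divided by a positive `C¹` function. -/
lemma IsC1Test.div (hΩ : IsOpen Ω) {w : EuclideanSpace ℝ (Fin d) → ℝ} (hw : IsC1Test Ω w)
    (hv : ContDiffOn ℝ 1 v Ω) (hv0 : ∀ x ∈ Ω, 0 < v x) : IsC1Test Ω (fun x => w x / v x) :=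
  IsC1Test.of_contDiffOn hΩ (hw.contDiff.contDiffOn.div hv fun x hx => (hv0 x hx).ne') hw
    fun x hx => by simp [hx]

lemma gradient_eq_of_div (hΩ : IsOpen Ω) {w : EuclideanSpace ℝ (Fin d) → ℝ} (hw : IsC1Test Ω w)
    (hv : ContDiffOn ℝ 1 v Ω) (hv0 : ∀ x ∈ Ω, 0 < v x) {x : EuclideanSpace ℝ (Fin d)}
    (hx : x ∈ Ω) : gradient w x =
      v x • gradient (fun x => w x / v x) x + (w x / v x) • gradient v x := by
  have h1 : w =ᶠ[𝓝 x] fun y => v y * (w y / v y) := by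
    filter_upwards [hΩ.mem_nhds hx] with y hy
    rw [mul_div_cancel₀ _ (hv0 y hy).ne']
  rw [h1.gradient_eq]
  exact (((hv.differentiableOn one_ne_zero).differentiableAt (hΩ.mem_nhds hx)).hasGradientAt.mul'
    ((hw.div hΩ hv hv0).contDiff.hasGradientAt x)).gradient

/-- Picone's identity: the energy relative to a ground state is an integrated Bregman divergence. -/
lemma IsEnergyGroundState.energy_eq_integral_bregman (h : IsEnergyGroundState Ω U p v)
    (hΩ : IsOpen Ω) (hp : 1 < p) {w : EuclideanSpace ℝ (Fin d) → ℝ} (hw : IsC1Test Ω w) :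
    IntegrableOn (fun x => bregman p (gradient w x) ((w x / v x) • gradient v x)) Ω ∧
    energy Ω U p w = ∫ x in Ω, bregman p (gradient w x) ((w x / v x) • gradient v x) := by
  have hp0 : 0 < p := by linarith
  have hg := hw.div hΩ h.contDiffOn h.pos
  set g : EuclideanSpace ℝ (Fin d) → ℝ := fun x => w x / v x with hgdef
  set φ : EuclideanSpace ℝ (Fin d) → ℝ := fun x => v x * |g x| ^ p with hφdef
  have hφ : IsC1Test Ω φ := by
    refine IsC1Test.of_contDiffOn hΩ (h.contDiffOn.mul ?_) hw fun x hx => ?_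
    · exact ((contDiff_norm_rpow hp).comp hg.contDiff).contDiffOn
    · simp [hφdef, hgdef, hx, hp0.ne']
  have hEL : IntegrableOn (fun x => ⟪dualityMap p (gradient v x), gradient φ x⟫
      + U x * (⟪dualityMap p (v x), φ x⟫)) Ω := by
    refine Integrable.add ?_ (h.potential.bdd.integrableOn_mul h.potential.meas ?_ hφ.compact
      hφ.subset fun x hx => ?_)
    · refine integrableOn_of_continuousOn_of_eq_zero hΩ (((continuous_dualityMap hp).comp_continuousOn
        (h.contDiffOn.continuousOn_gradient hΩ)).inner hφ.contDiff.continuous_gradient.continuousOn)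
        hφ.compact hφ.subset fun x hx => ?_
      rw [gradient_eq_zero_of_notMem_tsupport hx, inner_zero_right]
    · refine integrableOn_of_continuousOn_of_eq_zero hΩ (((continuous_dualityMap hp).comp_continuousOn
        h.contDiffOn.continuousOn).inner hφ.contDiff.continuous.continuousOn)
        hφ.compact hφ.subset fun x hx => ?_
      rw [image_eq_zero_of_notMem_tsupport hx, inner_zero_right]
    · rw [image_eq_zero_of_notMem_tsupport hx, inner_zero_right]
  have hpt : ∀ x ∈ Ω, ‖gradient w x‖ ^ p + U x * |w x| ^ p
      - (⟪dualityMap p (gradient v x), gradient φ x⟫ + U x * (⟪dualityMap p (v x), φ x⟫))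
      = bregman p (gradient w x) (g x • gradient v x) := by
    intro x hx
    have h1 := gradient_eq_of_div hΩ hw h.contDiffOn h.pos hx
    have h2 : gradient φ x = v x • (p * (|g x| ^ (p - 2) * g x)) • gradient g x
        + |g x| ^ p • gradient v x :=
      (((h.contDiffOn.differentiableOn one_ne_zero).differentiableAt
        (hΩ.mem_nhds hx)).hasGradientAt.mul' ((hg.contDiff.hasGradientAt x).scomp
        (hasDerivAt_abs_rpow_mul hp (g x)))).gradient
    have h3 : gradient w x - g x • gradient v x = v x • gradient g x := by
      rw [h1]
      abel
    have h4 : ⟪dualityMap p (v x), φ x⟫ = |w x| ^ p := by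
      have : φ x = |g x| ^ p • v x := by simp [hφdef, mul_comm]
      rw [this, real_inner_smul_right, inner_dualityMap_self hp, Real.norm_eq_abs,
        ← Real.mul_rpow (abs_nonneg _) (abs_nonneg _), ← abs_mul, hgdef,
        div_mul_cancel₀ _ (h.pos x hx).ne']
    rw [bregman, h3, h4, h2, dualityMap_smul, norm_smul, Real.mul_rpow (norm_nonneg _)
      (norm_nonneg _), inner_add_right, real_inner_smul_right, real_inner_smul_right,
      real_inner_smul_right, real_inner_smul_left, real_inner_smul_right,
      inner_dualityMap_self hp, Real.norm_eq_abs]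
    ring
  have hE := h.potential.integrableOn_energy hp0 hw
  constructor
  · exact (hE.sub hEL).congr_fun (fun x hx => hpt x hx) hΩ.measurableSet
  · rw [← setIntegral_congr_fun hΩ.measurableSet hpt, integral_sub hE hEL,
      h.integral_eq_zero hΩ hp hφ, sub_zero, energy]

end GroundState

section Poincare

open scoped ENNReal

lemma enorm_sub_le_lintegral_fderiv {E : Type*} [NormedAddCommGroup E] [NormedSpace ℝ E]
    {g : E → ℝ} (hg : ContDiff ℝ 1 g) (x y : E) :
    ‖g y - g x‖ₑ ≤ ∫⁻ t in Set.Icc (0 : ℝ) 1, ‖fderiv ℝ g ((1 - t) • x + t • y)‖ₑ * ‖y - x‖ₑ := by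
  have hc : ContDiff ℝ 1 fun t : ℝ => (1 - t) • x + t • y := by fun_prop
  have h := enorm_sub_le_lintegral_deriv_of_contDiffOn_Icc (f := fun t : ℝ => g ((1 - t) • x + t • y))
    (hg.comp hc).contDiffOn zero_le_one
  simp only [one_smul, sub_self, zero_smul, zero_add, sub_zero, add_zero] at h
  refine h.trans (lintegral_mono fun t => ?_)
  have hd : HasDerivAt (fun t : ℝ => (1 - t) • x + t • y) (y - x) t := by
    have := (((hasDerivAt_id t).const_sub 1).smul_const x).add ((hasDerivAt_id t).smul_const y)
    rw [show (-1 : ℝ) • x + (1 : ℝ) • y = y - x by simp; abel] at this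
    exact this
  have := ((hg.differentiable one_ne_zero _).hasFDerivAt.comp_hasDerivAt t hd).deriv
  simp only [Function.comp_def] at this
  rw [this]
  exact ContinuousLinearMap.le_opENorm _ _

variable {E : Type*} [NormedAddCommGroup E] [NormedSpace ℝ E] [FiniteDimensional ℝ E]
  [MeasurableSpace E] [BorelSpace E] (μ : Measure E) [μ.IsAddHaarMeasure]

lemma lintegral_comp_smul_add {s : ℝ} (hs : s ≠ 0) (b : E) {F : E → ℝ≥0∞} (hF : Measurable F) :
    ∫⁻ x, F (s • x + b) ∂μ
      = ENNReal.ofReal |(s ^ Module.finrank ℝ E)⁻¹| * ∫⁻ x, F x ∂μ := by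
  have h1 : ∫⁻ x, F (s • x + b) ∂μ = ∫⁻ z, F (z + b) ∂(Measure.map (s • ·) μ) := by
    rw [lintegral_map (by fun_prop) (by fun_prop)]
  rw [h1, Measure.map_addHaar_smul μ hs, lintegral_smul_measure, lintegral_add_right_eq_self,
    smul_eq_mul]

lemma setLIntegral_comp_smul_add_le {s : ℝ} (hs : 1 / 2 ≤ s) {b : E} {F : E → ℝ≥0∞}
    (hF : Measurable F) {B : Set E} (hB : MeasurableSet B) (hsB : ∀ x ∈ B, s • x + b ∈ B) :
    ∫⁻ x in B, F (s • x + b) ∂μ ≤ 2 ^ Module.finrank ℝ E * ∫⁻ x in B, F x ∂μ := by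
  have hs0 : 0 < s := by linarith
  calc ∫⁻ x in B, F (s • x + b) ∂μ ≤ ∫⁻ x, B.indicator F (s • x + b) ∂μ := by
        rw [← lintegral_indicator hB]
        refine lintegral_mono fun x => ?_
        by_cases hx : x ∈ B
        · simp [hx, hsB x hx]
        · simp [hx]
    _ = ENNReal.ofReal |(s ^ Module.finrank ℝ E)⁻¹| * ∫⁻ x in B, F x ∂μ := by
        rw [lintegral_comp_smul_add μ hs0.ne' b (hF.indicator hB), lintegral_indicator hB]
    _ ≤ _ := by
        gcongr
        rw [abs_of_nonneg (by positivity), ← inv_pow, ENNReal.ofReal_pow (by positivity)]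
        gcongr
        rw [show (2 : ℝ≥0∞) = ENNReal.ofReal 2 by simp]
        refine ENNReal.ofReal_le_ofReal ?_
        rw [inv_le_comm₀ hs0 two_pos]
        linarith

/-- Mean oscillation on a bounded convex set is controlled by the gradient. -/
lemma lintegral_lintegral_enorm_sub_le {g : E → ℝ} (hg : ContDiff ℝ 1 g) {B : Set E}
    (hB : MeasurableSet B) (hBc : Convex ℝ B) :
    ∫⁻ x in B, ∫⁻ y in B, ‖g y - g x‖ₑ ∂μ ∂μ ≤
      2 ^ Module.finrank ℝ E * μ B * Metric.ediam B * ∫⁻ x in B, ‖fderiv ℝ g x‖ₑ ∂μ := by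
  set F : E → ℝ≥0∞ := fun x => ‖fderiv ℝ g x‖ₑ with hF
  have hFc : Continuous F := (hg.continuous_fderiv one_ne_zero).enorm
  set D := Metric.ediam B
  have h1 : ∀ t ∈ Set.Icc (0 : ℝ) 1, ∫⁻ x in B, ∫⁻ y in B, F ((1 - t) • x + t • y) ∂μ ∂μ ≤
      2 ^ Module.finrank ℝ E * μ B * ∫⁻ x in B, F x ∂μ := by
    intro t ht
    rcases le_total t (1 / 2) with h | h
    · rw [lintegral_lintegral_swap (by fun_prop)]
      calc _ ≤ ∫⁻ y in B, 2 ^ Module.finrank ℝ E * ∫⁻ x in B, F x ∂μ ∂μ :=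
            setLIntegral_mono' hB fun y hy => setLIntegral_comp_smul_add_le μ (by linarith)
              hFc.measurable hB fun x hx => hBc hx hy (by linarith [ht.2]) ht.1 (by ring)
        _ = _ := by
          rw [setLIntegral_const]
          ring
    · calc _ ≤ ∫⁻ x in B, 2 ^ Module.finrank ℝ E * ∫⁻ x in B, F x ∂μ ∂μ := by
            refine setLIntegral_mono' hB fun x hx => ?_
            simp_rw [add_comm ((1 - t) • x)]
            exact setLIntegral_comp_smul_add_le μ h hFc.measurable hB
              fun y hy => hBc hy hx ht.1 (by linarith [ht.2]) (by ring)
        _ = _ := by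
          rw [setLIntegral_const]
          ring
  calc ∫⁻ x in B, ∫⁻ y in B, ‖g y - g x‖ₑ ∂μ ∂μ
      ≤ ∫⁻ x in B, ∫⁻ y in B, (∫⁻ t in Set.Icc (0 : ℝ) 1, F ((1 - t) • x + t • y) * D)
        ∂μ ∂μ := by
        refine setLIntegral_mono' hB fun x hx => setLIntegral_mono' hB fun y hy =>
          (enorm_sub_le_lintegral_fderiv hg x y).trans (lintegral_mono fun t => ?_)
        gcongr
        rw [← edist_eq_enorm_sub]
        exact Metric.edist_le_ediam_of_mem hy hx
    _ = ∫⁻ t in Set.Icc (0 : ℝ) 1, ∫⁻ x in B, ∫⁻ y in B, F ((1 - t) • x + t • y) * D ∂μ ∂μ := by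
        have : ∀ x, ∫⁻ y in B, (∫⁻ t in Set.Icc (0 : ℝ) 1, F ((1 - t) • x + t • y) * D) ∂μ
            = ∫⁻ t in Set.Icc (0 : ℝ) 1, ∫⁻ y in B, F ((1 - t) • x + t • y) * D ∂μ := fun x =>
          lintegral_lintegral_swap (Measurable.aemeasurable (Measurable.mul_const
            (f := fun q : E × ℝ => F ((1 - q.2) • x + q.2 • q.1))
            (hFc.comp (by fun_prop)).measurable _))
        simp_rw [this]
        refine lintegral_lintegral_swap (Measurable.aemeasurable ?_)
        refine Measurable.lintegral_prod_right' (f := fun q : (E × ℝ) × E =>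
          F ((1 - q.1.2) • q.1.1 + q.1.2 • q.2) * D) (Measurable.mul_const
            (f := fun q : (E × ℝ) × E => F ((1 - q.1.2) • q.1.1 + q.1.2 • q.2)) ?_ _)
        exact (hFc.comp (by fun_prop)).measurable
    _ = ∫⁻ t in Set.Icc (0 : ℝ) 1, (∫⁻ x in B, ∫⁻ y in B, F ((1 - t) • x + t • y) ∂μ ∂μ) * D := by
        refine lintegral_congr fun t => ?_
        rw [← lintegral_mul_const]
        · refine lintegral_congr fun x => ?_
          rw [lintegral_mul_const]
          exact (hFc.comp (by fun_prop)).measurable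
        · refine Measurable.lintegral_prod_right' (f := fun q : E × E =>
            F ((1 - t) • q.1 + t • q.2)) ?_
          exact (hFc.comp (by fun_prop)).measurable
    _ ≤ ∫⁻ t in Set.Icc (0 : ℝ) 1, (2 ^ Module.finrank ℝ E * μ B * ∫⁻ x in B, F x ∂μ) * D := by
        refine setLIntegral_mono' measurableSet_Icc fun t ht => ?_
        gcongr
        exact h1 t ht
    _ = _ := by
        rw [setLIntegral_const]
        simp
        ring

lemma exists_lintegral_enorm_sub_le {g : E → ℝ} (hg : ContDiff ℝ 1 g) {B : Set E}
    (hB : MeasurableSet B) (hBc : Convex ℝ B) (hB0 : μ B ≠ 0) (hBt : μ B ≠ ∞) :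
    ∃ a : ℝ, ∫⁻ y in B, ‖g y - a‖ₑ ∂μ ≤
      2 ^ Module.finrank ℝ E * Metric.ediam B * ∫⁻ x in B, ‖fderiv ℝ g x‖ₑ ∂μ := by
  have hgc := hg.continuous
  obtain ⟨x, -, hx⟩ := exists_le_setLAverage (μ := μ) (s := B)
    (f := fun x => ∫⁻ y in B, ‖g y - g x‖ₑ ∂μ) hB0 hBt
    (Measurable.lintegral_prod_right' (f := fun q : E × E => ‖g q.2 - g q.1‖ₑ)
      (by fun_prop)).aemeasurable
  refine ⟨g x, hx.trans ?_⟩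
  rw [setLAverage_eq]
  refine ENNReal.div_le_of_le_mul ((lintegral_lintegral_enorm_sub_le μ hg hB hBc).trans_eq ?_)
  ring

/-- On a connected open set, functions with gradients vanishing in `L¹_loc` are asymptotically
constant in `L¹_loc`. -/
lemma exists_tendsto_lintegral_enorm_sub {O : Set E} (hO : IsOpen O) (hOc : IsConnected O)
    {g : ℕ → E → ℝ} (hg : ∀ n, ContDiff ℝ 1 (g n))
    (h : ∀ K ⊆ O, IsCompact K → Tendsto (fun n => ∫⁻ x in K, ‖fderiv ℝ (g n) x‖ₑ ∂μ) atTop (𝓝 0)) :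
    ∃ c : ℕ → ℝ, ∀ K ⊆ O, IsCompact K →
      Tendsto (fun n => ∫⁻ x in K, ‖g n x - c n‖ₑ ∂μ) atTop (𝓝 0) := by
  have hloc : ∀ x ∈ O, ∃ r > 0, ∃ a : ℕ → ℝ,
      Tendsto (fun n => ∫⁻ y in Metric.ball x r, ‖g n y - a n‖ₑ ∂μ) atTop (𝓝 0) := by
    intro x hx
    obtain ⟨r, hr, hrO⟩ := Metric.nhds_basis_closedBall.mem_iff.1 (hO.mem_nhds hx)
    choose a ha using fun n => exists_lintegral_enorm_sub_le μ (hg n)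
      (Metric.isOpen_ball (x := x) (ε := r)).measurableSet (convex_ball x r)
      (Metric.measure_ball_pos μ x hr).ne' measure_ball_lt_top.ne
    refine ⟨r, hr, a, tendsto_of_tendsto_of_tendsto_of_le_of_le tendsto_const_nhds ?_
      (fun _ => zero_le) ha⟩
    have h0 : Tendsto (fun n => ∫⁻ y in Metric.ball x r, ‖fderiv ℝ (g n) y‖ₑ ∂μ) atTop (𝓝 0) :=
      tendsto_of_tendsto_of_tendsto_of_le_of_le tendsto_const_nhds
        (h _ hrO (isCompact_closedBall x r)) (fun _ => zero_le)
        fun n => lintegral_mono_set Metric.ball_subset_closedBall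
    have hD : 2 ^ Module.finrank ℝ E * Metric.ediam (Metric.ball x r) ≠ ∞ :=
      ENNReal.mul_ne_top (by simp) Metric.isBounded_ball.ediam_ne_top
    simpa using ENNReal.Tendsto.const_mul h0 (Or.inr hD)
  obtain ⟨x₀, hx₀⟩ := hOc.nonempty
  obtain ⟨r₀, hr₀, c, hc⟩ := hloc x₀ hx₀
  set S : Set E := {x | ∃ r > 0,
    Tendsto (fun n => ∫⁻ y in Metric.ball x r, ‖g n y - c n‖ₑ ∂μ) atTop (𝓝 0)} with hS
  have hmono : ∀ {s t : Set E}, s ⊆ t →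
      Tendsto (fun n => ∫⁻ y in t, ‖g n y - c n‖ₑ ∂μ) atTop (𝓝 0) →
      Tendsto (fun n => ∫⁻ y in s, ‖g n y - c n‖ₑ ∂μ) atTop (𝓝 0) := fun hst ht =>
    tendsto_of_tendsto_of_tendsto_of_le_of_le tendsto_const_nhds ht (fun _ => zero_le)
      fun n => lintegral_mono_set hst
  have hSo : IsOpen S := by
    refine Metric.isOpen_iff.2 fun x ⟨r, hr, hx⟩ => ⟨r, hr, fun y hy => ?_⟩
    obtain ⟨s, hs, hsy⟩ := Metric.isOpen_iff.1 (Metric.isOpen_ball (x := x) (ε := r)) y hy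
    exact ⟨s, hs, hmono hsy hx⟩
  have hOS : O ⊆ S := by
    refine hOc.isPreconnected.subset_of_closure_inter_subset hSo ⟨x₀, hx₀, r₀, hr₀, hc⟩ ?_
    rintro x ⟨hxS, hxO⟩
    obtain ⟨r, hr, a, ha⟩ := hloc x hxO
    obtain ⟨y, hyx, s, hs, hy⟩ := mem_closure_iff.1 hxS _ Metric.isOpen_ball
      (Metric.mem_ball_self hr)
    set B := Metric.ball y s ∩ Metric.ball x r
    have hB : IsOpen B := Metric.isOpen_ball.inter Metric.isOpen_ball
    have hB0 : μ B ≠ 0 := (hB.measure_pos μ ⟨y, Metric.mem_ball_self hs, hyx⟩).ne'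
    have hBt : μ B ≠ ∞ := ((measure_mono Set.inter_subset_left).trans_lt measure_ball_lt_top).ne
    have hac : Tendsto (fun n => ‖a n - c n‖ₑ) atTop (𝓝 0) := by
      have h1 : ∀ n, ‖a n - c n‖ₑ * μ B ≤ ∫⁻ z in Metric.ball x r, ‖g n z - a n‖ₑ ∂μ
          + ∫⁻ z in Metric.ball y s, ‖g n z - c n‖ₑ ∂μ := by
        intro n
        have hgm := (hg n).continuous
        rw [← setLIntegral_const]
        calc _ ≤ ∫⁻ z in B, (‖g n z - a n‖ₑ + ‖g n z - c n‖ₑ) ∂μ := by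
              refine lintegral_mono fun z => ?_
              calc ‖a n - c n‖ₑ = ‖(g n z - c n) - (g n z - a n)‖ₑ := by congr 1; ring
                _ ≤ _ := by
                  rw [add_comm]
                  exact enorm_sub_le
          _ = ∫⁻ z in B, ‖g n z - a n‖ₑ ∂μ + ∫⁻ z in B, ‖g n z - c n‖ₑ ∂μ :=
              lintegral_add_left (by fun_prop) _
          _ ≤ _ := add_le_add (lintegral_mono_set Set.inter_subset_right)
              (lintegral_mono_set Set.inter_subset_left)
      have h2 := ENNReal.Tendsto.mul_const (b := (μ B)⁻¹) (ha.add hy)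
        (Or.inr (ENNReal.inv_ne_top.2 hB0))
      rw [add_zero, zero_mul] at h2
      refine tendsto_of_tendsto_of_tendsto_of_le_of_le tendsto_const_nhds h2 (fun _ => zero_le)
        fun n => ?_
      rw [← div_eq_mul_inv]
      exact ENNReal.le_div_iff_mul_le (Or.inl hB0) (Or.inl hBt) |>.2 (h1 n)
    refine ⟨r, hr, ?_⟩
    have h3 := ha.add (ENNReal.Tendsto.mul_const (b := μ (Metric.ball x r)) hac
      (Or.inr measure_ball_lt_top.ne))
    rw [zero_mul, add_zero] at h3
    refine tendsto_of_tendsto_of_tendsto_of_le_of_le tendsto_const_nhds h3 (fun _ => zero_le)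
      fun n => ?_
    have hgm := (hg n).continuous
    simp only
    rw [← setLIntegral_const, ← lintegral_add_left (by fun_prop)]
    refine lintegral_mono fun z => ?_
    calc ‖g n z - c n‖ₑ = ‖(g n z - a n) + (a n - c n)‖ₑ := by congr 1; ring
      _ ≤ _ := enorm_add_le _ _
  refine ⟨c, fun K hKO hK => ?_⟩
  refine hK.induction_on (p := fun s => Tendsto (fun n => ∫⁻ y in s, ‖g n y - c n‖ₑ ∂μ) atTop (𝓝 0))
    (by simp) (fun s t hst => hmono hst) (fun s t hs ht => ?_) fun x hx => ?_
  · have := hs.add ht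
    rw [add_zero] at this
    exact tendsto_of_tendsto_of_tendsto_of_le_of_le tendsto_const_nhds this (fun _ => zero_le)
      fun n => lintegral_union_le _ _ _
  · obtain ⟨r, hr, hx⟩ := hOS (hKO hx)
    exact ⟨_, mem_nhdsWithin_of_mem_nhds (Metric.ball_mem_nhds x hr), hx⟩

end Poincare

section AsymptoticConstancy

variable {d : ℕ} {Ω : Set (EuclideanSpace ℝ (Fin d))}
variable {U v : EuclideanSpace ℝ (Fin d) → ℝ} {p : ℝ}

lemma tendsto_zero_of_forall_eventually_le {α : Type*} {l : Filter α} {f : α → ℝ}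
    (hf0 : ∀ n, 0 ≤ f n) (h : ∀ ε > 0, ∀ᶠ n in l, f n ≤ ε) : Tendsto f l (𝓝 0) := by
  refine tendsto_order.2 ⟨fun a ha => Eventually.of_forall fun n => ha.trans_le (hf0 n),
    fun a ha => ?_⟩
  filter_upwards [h (a / 2) (half_pos ha)] with n hn
  linarith

lemma IsEnergyGroundState.tendsto_integral_gradient_div_rpow (h : IsEnergyGroundState Ω U p v)
    (hΩ : IsOpen Ω) (hp : 1 < p) {w : ℕ → EuclideanSpace ℝ (Fin d) → ℝ}
    (hw : ∀ n, IsC1Test Ω (w n)) (hE : Tendsto (fun n => energy Ω U p (w n)) atTop (𝓝 0))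
    {K : Set (EuclideanSpace ℝ (Fin d))} (hK : IsCompact K) (hKΩ : K ⊆ Ω)
    {M : ℝ} (hM : ∀ n, ∫ x in K, |w n x| ^ p ≤ M) :
    Tendsto (fun n => ∫ x in K, ‖gradient (fun x => w n x / v x) x‖ ^ p) atTop (𝓝 0) := by
  have hp0 : 0 < p := by linarith
  obtain ⟨m, hm, hmv⟩ := exists_pos_le_of_isCompact h.contDiffOn.continuousOn h.pos hK hKΩ
  obtain ⟨G, hG⟩ := hK.exists_bound_of_continuousOn
    ((h.contDiffOn.continuousOn_gradient hΩ).mono hKΩ)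
  have hg := fun n => (hw n).div hΩ h.contDiffOn h.pos
  refine tendsto_zero_of_forall_eventually_le (fun n => integral_nonneg fun x => by positivity)
    fun ε hε => ?_
  set A := max G 0 / m
  have hA : 0 ≤ A := by positivity
  have hM' : M < |M| + 1 := by linarith [le_abs_self M]
  obtain ⟨δ, hδ, hδε⟩ : ∃ δ > 0, δ * A ^ p * (|M| + 1) ≤ m ^ p * ε / 2 := by
    refine ⟨m ^ p * ε / 2 / (A ^ p * (|M| + 1) + 1), by positivity, ?_⟩
    rw [mul_assoc, div_mul_eq_mul_div, div_le_iff₀ (by positivity)]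
    gcongr
    linarith
  obtain ⟨C, hC, hCb⟩ := exists_norm_sub_rpow_le_bregman
    (F := EuclideanSpace ℝ (Fin d)) hp hδ
  have hpt : ∀ n, ∀ x ∈ K, m ^ p * ‖gradient (fun x => w n x / v x) x‖ ^ p ≤
      δ * A ^ p * |w n x| ^ p +
        C * bregman p (gradient (w n) x) ((w n x / v x) • gradient v x) := by
    intro n x hx
    have h1 := gradient_eq_of_div hΩ (hw n) h.contDiffOn h.pos (hKΩ hx)
    have h2 : gradient (w n) x - (w n x / v x) • gradient v x
        = v x • gradient (fun x => w n x / v x) x := by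
      rw [h1]
      abel
    have h3 := hCb (gradient (w n) x) ((w n x / v x) • gradient v x)
    rw [h2, norm_smul, Real.norm_of_nonneg (h.pos x (hKΩ hx)).le,
      mul_rpow (h.pos x (hKΩ hx)).le (norm_nonneg _)] at h3
    have h4 : m ^ p ≤ v x ^ p := rpow_le_rpow hm.le (hmv x hx) hp0.le
    have h5 : ‖(w n x / v x) • gradient v x‖ ^ p ≤ A ^ p * |w n x| ^ p := by
      rw [← mul_rpow hA (abs_nonneg _)]
      refine rpow_le_rpow (norm_nonneg _) ?_ hp0.le
      rw [norm_smul, norm_div, Real.norm_eq_abs, Real.norm_of_nonneg (h.pos x (hKΩ hx)).le]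
      calc |w n x| / v x * ‖gradient v x‖ ≤ |w n x| / m * max G 0 := by
            gcongr
            · exact hmv x hx
            · exact (hG x hx).trans (le_max_left _ _)
        _ = A * |w n x| := by ring
    calc _ ≤ v x ^ p * ‖gradient (fun x => w n x / v x) x‖ ^ p := by gcongr
      _ ≤ _ := h3
      _ ≤ δ * (A ^ p * |w n x| ^ p) +
          C * bregman p (gradient (w n) x) ((w n x / v x) • gradient v x) := by gcongr
      _ = _ := by ring
  have hint : ∀ n, m ^ p * ∫ x in K, ‖gradient (fun x => w n x / v x) x‖ ^ p ≤
      δ * A ^ p * M + C * energy Ω U p (w n) := by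
    intro n
    obtain ⟨hbi, hbe⟩ := h.energy_eq_integral_bregman hΩ hp (hw n)
    have i1 : IntegrableOn (fun x => δ * A ^ p * |w n x| ^ p) K :=
      ((hw n).integrableOn_rpow hp0).integrableOn.const_mul _
    have i2 : IntegrableOn (fun x =>
        C * bregman p (gradient (w n) x) ((w n x / v x) • gradient v x)) K :=
      (hbi.mono_set hKΩ).const_mul _
    rw [← integral_const_mul]
    calc _ ≤ ∫ x in K, (δ * A ^ p * |w n x| ^ p +
          C * bregman p (gradient (w n) x) ((w n x / v x) • gradient v x)) :=
          setIntegral_mono_on (((hg n).integrable_gradient_rpow hp0).integrableOn.const_mul _)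
            (i1.add i2) hK.measurableSet (hpt n)
      _ = δ * A ^ p * (∫ x in K, |w n x| ^ p) +
          C * ∫ x in K, bregman p (gradient (w n) x) ((w n x / v x) • gradient v x) := by
          rw [integral_add i1 i2, integral_const_mul, integral_const_mul]
      _ ≤ _ := by
          rw [hbe]
          gcongr
          · exact hM n
          · exact Eventually.of_forall fun x => bregman_nonneg hp _ _
  have hev : ∀ᶠ n in atTop, C * energy Ω U p (w n) < m ^ p * ε / 2 := by
    have := hE.const_mul C
    rw [mul_zero] at this
    exact this.eventually_lt_const (by positivity)
  filter_upwards [hev] with n hn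
  have h6 : δ * A ^ p * M ≤ δ * A ^ p * (|M| + 1) := by gcongr
  have h7 := hint n
  have h8 : 0 < m ^ p := by positivity
  refine le_of_mul_le_mul_left ?_ h8
  linarith

lemma lintegral_enorm_eq_ofReal_integral {α : Type*} [MeasurableSpace α] {μ : Measure α}
    {F : Type*} [NormedAddCommGroup F] {f : α → F} (hf : Integrable (fun x => ‖f x‖) μ) :
    ∫⁻ x, ‖f x‖ₑ ∂μ = ENNReal.ofReal (∫ x, ‖f x‖ ∂μ) := by
  rw [ofReal_integral_eq_lintegral_ofReal hf (Eventually.of_forall fun x => norm_nonneg _)]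
  simp

/-- Quotients of functions with vanishing energy by the ground state are asymptotically constant. -/
lemma IsEnergyGroundState.exists_tendsto_integral_div_sub (h : IsEnergyGroundState Ω U p v)
    (hΩ : IsOpen Ω) (hΩc : IsConnected Ω) (hp : 1 < p) {w : ℕ → EuclideanSpace ℝ (Fin d) → ℝ}
    (hw : ∀ n, IsC1Test Ω (w n)) (hE : Tendsto (fun n => energy Ω U p (w n)) atTop (𝓝 0))
    (hM : ∀ K ⊆ Ω, IsCompact K → ∃ M : ℝ, ∀ n, ∫ x in K, |w n x| ^ p ≤ M) :
    ∃ c : ℕ → ℝ, ∀ K ⊆ Ω, IsCompact K →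
      Tendsto (fun n => ∫ x in K, |w n x / v x - c n|) atTop (𝓝 0) := by
  have hg := fun n => (hw n).div hΩ h.contDiffOn h.pos
  have hgrad : ∀ K ⊆ Ω, IsCompact K → Tendsto (fun n =>
      ∫⁻ x in K, ‖fderiv ℝ (fun x => w n x / v x) x‖ₑ) atTop (𝓝 0) := by
    intro K hKΩ hK
    obtain ⟨M, hM⟩ := hM K hKΩ hK
    have : IsFiniteMeasure (volume.restrict K) := ⟨by simpa using hK.measure_lt_top⟩
    have h1 := tendsto_integral_rpow_of_lt one_pos hp (fun n x => norm_nonneg _)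
      (fun n => ((hg n).integrable_gradient_rpow (by linarith)).integrableOn)
      (h.tendsto_integral_gradient_div_rpow hΩ hp hw hE hK hKΩ hM)
    have h2 := ENNReal.tendsto_ofReal h1
    rw [ENNReal.ofReal_zero] at h2
    refine h2.congr fun n => ?_
    simp only [rpow_one, norm_gradient]
    refine (lintegral_enorm_eq_ofReal_integral ?_).symm
    exact ((hg n).contDiff.continuous_fderiv one_ne_zero).norm.continuousOn.integrableOn_compact hK
  obtain ⟨c, hc⟩ := exists_tendsto_lintegral_enorm_sub volume hΩ hΩc
    (g := fun n x => w n x / v x) (fun n => (hg n).contDiff) hgrad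
  refine ⟨c, fun K hKΩ hK => ?_⟩
  have h1 := (ENNReal.tendsto_toReal ENNReal.zero_ne_top).comp (hc K hKΩ hK)
  refine h1.congr fun n => ?_
  have i : IntegrableOn (fun x => ‖w n x / v x - c n‖) K :=
    (((hg n).contDiff.continuous.sub continuous_const).norm.continuousOn).integrableOn_compact hK
  simp only [Function.comp_apply]
  rw [lintegral_enorm_eq_ofReal_integral i,
    ENNReal.toReal_ofReal (integral_nonneg fun x => norm_nonneg _)]
  rfl

/-- Energy-vanishing sequences asymptotically orthogonal to a function that is not orthogonal to
the ground state vanish in `L¹_loc`. -/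
lemma IsEnergyGroundState.tendsto_integral_abs (h : IsEnergyGroundState Ω U p v)
    (hΩ : IsOpen Ω) (hΩc : IsConnected Ω) (hp : 1 < p) {w : ℕ → EuclideanSpace ℝ (Fin d) → ℝ}
    (hw : ∀ n, IsC1Test Ω (w n)) (hE : Tendsto (fun n => energy Ω U p (w n)) atTop (𝓝 0))
    (hM : ∀ K ⊆ Ω, IsCompact K → ∃ M : ℝ, ∀ n, ∫ x in K, |w n x| ^ p ≤ M)
    {ψ : EuclideanSpace ℝ (Fin d) → ℝ} (hψ : IsC1Test Ω ψ) (hψv : ∫ x in Ω, ψ x * v x ≠ 0)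
    (hψw : Tendsto (fun n => ∫ x in Ω, ψ x * w n x) atTop (𝓝 0))
    {K : Set (EuclideanSpace ℝ (Fin d))} (hKΩ : K ⊆ Ω) (hK : IsCompact K) :
    Tendsto (fun n => ∫ x in K, |w n x|) atTop (𝓝 0) := by
  obtain ⟨c, hc⟩ := h.exists_tendsto_integral_div_sub hΩ hΩc hp hw hE hM
  have hvc := h.contDiffOn.continuousOn
  have hgc := fun n => ((hw n).div hΩ h.contDiffOn h.pos).contDiff.continuous
  have hψvc : ContinuousOn (fun x => ψ x * v x) Ω := hψ.contDiff.continuous.continuousOn.mul hvc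
  have hc0 : Tendsto c atTop (𝓝 0) := by
    obtain ⟨M, hMb⟩ := hψ.compact.exists_bound_of_continuousOn (hψvc.mono hψ.subset)
    have h0 : Tendsto (fun n => ∫ x in Ω, ψ x * v x * (w n x / v x - c n)) atTop (𝓝 0) := by
      have h1 := (hc _ hψ.subset hψ.compact).const_mul M
      rw [mul_zero] at h1
      refine squeeze_zero_norm (fun n => ?_) h1
      rw [setIntegral_eq_of_subset_of_forall_sdiff_eq_zero (s := tsupport ψ) (t := Ω)
        (f := fun x => ψ x * v x * (w n x / v x - c n)) hΩ.measurableSet hψ.subset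
        fun x hx => by rw [image_eq_zero_of_notMem_tsupport hx.2, zero_mul, zero_mul]]
      rw [← integral_const_mul]
      refine norm_integral_le_of_norm_le ?_ ?_
      · exact (((hgc n).sub continuous_const).abs.continuousOn.integrableOn_compact
          hψ.compact).const_mul _
      · filter_upwards [ae_restrict_mem hψ.compact.measurableSet] with x hx
        rw [norm_mul, Real.norm_eq_abs (w n x / v x - c n)]
        gcongr
        exact hMb x hx
    have h2 : ∀ n, c n = ((∫ x in Ω, ψ x * w n x) -
        ∫ x in Ω, ψ x * v x * (w n x / v x - c n)) / ∫ x in Ω, ψ x * v x := by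
      intro n
      rw [eq_div_iff hψv, ← integral_const_mul]
      have i1 : IntegrableOn (fun x => ψ x * w n x) Ω :=
        integrableOn_of_continuousOn_of_eq_zero hΩ (hψ.contDiff.continuous.mul
          (hw n).contDiff.continuous).continuousOn hψ.compact hψ.subset
          fun x hx => by rw [image_eq_zero_of_notMem_tsupport hx, zero_mul]
      have i2 : IntegrableOn (fun x => ψ x * v x * (w n x / v x - c n)) Ω :=
        integrableOn_of_continuousOn_of_eq_zero hΩ (hψvc.mul
          ((hgc n).sub continuous_const).continuousOn) hψ.compact hψ.subset
          fun x hx => by rw [image_eq_zero_of_notMem_tsupport hx, zero_mul, zero_mul]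
      rw [← integral_sub i1 i2]
      refine setIntegral_congr_fun hΩ.measurableSet fun x hx => ?_
      have := (h.pos x hx).ne'
      field_simp
      ring
    have h3 := (hψw.sub h0).div_const (∫ x in Ω, ψ x * v x)
    rw [sub_zero, zero_div] at h3
    exact h3.congr fun n => (h2 n).symm
  obtain ⟨M, hMb⟩ := hK.exists_bound_of_continuousOn (hvc.mono hKΩ)
  have h4 := ((hc K hKΩ hK).add (hc0.abs.mul_const (volume.real K))).const_mul M
  rw [abs_zero, zero_mul, add_zero, mul_zero] at h4
  refine squeeze_zero (fun n => integral_nonneg fun x => abs_nonneg _) (fun n => ?_) h4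
  have i1 : IntegrableOn (fun x => |w n x / v x - c n|) K :=
    ((hgc n).sub continuous_const).abs.continuousOn.integrableOn_compact hK
  have i2 : IntegrableOn (fun _ => |c n|) K := continuousOn_const.integrableOn_compact hK
  have h5 : volume.real K * |c n| = ∫ x in K, |c n| := by simp
  rw [mul_comm |c n|, h5, ← integral_add i1 i2, ← integral_const_mul]
  refine setIntegral_mono_on ((hw n).contDiff.continuous.abs.continuousOn.integrableOn_compact hK)
    ((i1.add i2).const_mul _) hK.measurableSet fun x hx => ?_
  have h6 : w n x = v x * ((w n x / v x - c n) + c n) := by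
    have := (h.pos x (hKΩ hx)).ne'
    field_simp
    ring
  calc |w n x| = |v x| * |(w n x / v x - c n) + c n| := by rw [← abs_mul, ← h6]
    _ ≤ M * (|w n x / v x - c n| + |c n|) := by
      have h7 : |v x| ≤ M := hMb x hx
      have h8 := (abs_nonneg _).trans h7
      gcongr
      exact abs_add_le _ _

/-- Under a bound in a weighted `L^q`, convergence in `L¹_loc` improves to `L^p_loc`, `p < q`. -/
lemma tendsto_integral_rpow_of_tendsto_integral_abs (hΩ : IsOpen Ω) {q : ℝ} (hp : 1 < p)
    (hpq : p < q) {W : EuclideanSpace ℝ (Fin d) → ℝ} (hWc : ContinuousOn W Ω)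
    (hWpos : ∀ x ∈ Ω, 0 < W x) {w : ℕ → EuclideanSpace ℝ (Fin d) → ℝ}
    (hw : ∀ n, IsC1Test Ω (w n)) (hwW : ∀ n, ∫ x in Ω, W x * |w n x| ^ q ≤ 1)
    {K : Set (EuclideanSpace ℝ (Fin d))} (hKΩ : K ⊆ Ω) (hK : IsCompact K)
    (h : Tendsto (fun n => ∫ x in K, |w n x|) atTop (𝓝 0)) :
    Tendsto (fun n => ∫ x in K, |w n x| ^ p) atTop (𝓝 0) := by
  refine tendsto_zero_of_forall_eventually_le (fun n => integral_nonneg fun x => by positivity)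
    fun ε hε => ?_
  obtain ⟨m, hm, hmW⟩ := exists_pos_le_of_isCompact hWc hWpos hK hKΩ
  obtain ⟨C, hC, hCb⟩ := exists_rpow_le_mul_add_mul_rpow hp hpq (s := m * ε / 2) (by positivity)
  have hev : ∀ᶠ n in atTop, C * ∫ x in K, |w n x| < ε / 2 := by
    have := h.const_mul C
    rw [mul_zero] at this
    exact this.eventually_lt_const (by positivity)
  filter_upwards [hev] with n hn
  have iW := (hw n).integrableOn_mul_rpow hΩ hWc (q := q) (by linarith)
  have i1 : IntegrableOn (fun x => C * |w n x|) K :=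
    ((hw n).contDiff.continuous.abs.continuousOn.integrableOn_compact hK).const_mul _
  have i2 : IntegrableOn (fun x => ε / 2 * (W x * |w n x| ^ q)) K :=
    (iW.mono_set hKΩ).const_mul _
  calc ∫ x in K, |w n x| ^ p ≤ ∫ x in K, (C * |w n x| + ε / 2 * (W x * |w n x| ^ q)) := by
        refine setIntegral_mono_on ((hw n).integrableOn_rpow (by linarith)).integrableOn
          (i1.add i2) hK.measurableSet fun x hx => ?_
        refine (hCb _ (abs_nonneg _)).trans ?_
        have : m * |w n x| ^ q ≤ W x * |w n x| ^ q := by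
          gcongr
          exact hmW x hx
        nlinarith
    _ = C * (∫ x in K, |w n x|) + ε / 2 * ∫ x in K, W x * |w n x| ^ q := by
        rw [integral_add i1 i2, integral_const_mul, integral_const_mul]
    _ ≤ ε / 2 + ε / 2 * 1 := by
        gcongr
        refine le_trans (setIntegral_mono_set iW ?_ hKΩ.eventuallyLE) (hwW n)
        filter_upwards [ae_restrict_mem hΩ.measurableSet] with x hx
        have := hWpos x hx
        simp only [Pi.zero_apply]
        positivity
    _ = ε := by ring

/-- A weighted `L^q` bound yields `L^p_loc` bounds, `p < q`. -/
lemma exists_integral_rpow_le (hΩ : IsOpen Ω) {q : ℝ} (hp : 0 < p)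
    (hpq : p < q) {W : EuclideanSpace ℝ (Fin d) → ℝ} (hWc : ContinuousOn W Ω)
    (hWpos : ∀ x ∈ Ω, 0 < W x)
    {K : Set (EuclideanSpace ℝ (Fin d))} (hKΩ : K ⊆ Ω) (hK : IsCompact K) :
    ∃ M : ℝ, ∀ w, IsC1Test Ω w → ∫ x in Ω, W x * |w x| ^ q ≤ 1 → ∫ x in K, |w x| ^ p ≤ M := by
  obtain ⟨m, hm, hmW⟩ := exists_pos_le_of_isCompact hWc hWpos hK hKΩ
  obtain ⟨C, hC, hCb⟩ := exists_rpow_le_add_mul_rpow hp hpq one_pos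
  refine ⟨volume.real K + C / m, fun w hw hwW => ?_⟩
  have iW := hw.integrableOn_mul_rpow hΩ hWc (q := q) (by linarith)
  have i1 : IntegrableOn (fun _ => (1 : ℝ)) K := continuousOn_const.integrableOn_compact hK
  have i2 : IntegrableOn (fun x => C / m * (W x * |w x| ^ q)) K :=
    (iW.mono_set hKΩ).const_mul _
  calc ∫ x in K, |w x| ^ p ≤ ∫ x in K, (1 + C / m * (W x * |w x| ^ q)) := by
        refine setIntegral_mono_on (hw.integrableOn_rpow hp).integrableOn
          (i1.add i2) hK.measurableSet fun x hx => ?_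
        refine (hCb _ (abs_nonneg _)).trans ?_
        have : m * |w x| ^ q ≤ W x * |w x| ^ q := by
          gcongr
          exact hmW x hx
        calc 1 + C * |w x| ^ q = 1 + C / m * (m * |w x| ^ q) := by field_simp
          _ ≤ _ := by gcongr
    _ = volume.real K + C / m * ∫ x in K, W x * |w x| ^ q := by
        rw [integral_add i1 i2, integral_const_mul]
        simp
    _ ≤ volume.real K + C / m * 1 := by
        gcongr
        refine le_trans (setIntegral_mono_set iW ?_ hKΩ.eventuallyLE) hwW
        filter_upwards [ae_restrict_mem hΩ.measurableSet] with x hx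
        have := hWpos x hx
        simp only [Pi.zero_apply]
        positivity
    _ = _ := by ring

end AsymptoticConstancy

section Critical

variable {d : ℕ} {Ω : Set (EuclideanSpace ℝ (Fin d))}
variable {U V Vt W v : EuclideanSpace ℝ (Fin d) → ℝ} {p : ℝ}

lemma exists_isCompact_setIntegral_sdiff_lt (hΩ : IsOpen Ω) {H : EuclideanSpace ℝ (Fin d) → ℝ}
    (hH : IntegrableOn H Ω) (hH0 : ∀ x ∈ Ω, 0 ≤ H x) {ε : ℝ} (hε : 0 < ε) :
    ∃ K ⊆ Ω, IsCompact K ∧ ∫ x in Ω \ K, H x < ε := by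
  set ν := (volume.restrict Ω).withDensity fun x => ENNReal.ofReal (H x) with hν
  have : IsFiniteMeasure ν := isFiniteMeasure_withDensity_ofReal hH.hasFiniteIntegral
  obtain ⟨K, hKΩ, hK, hlt⟩ := hΩ.measurableSet.exists_isCompact_sdiff_lt (μ := ν)
    (measure_ne_top _ _) (ENNReal.ofReal_pos.2 hε).ne'
  refine ⟨K, hKΩ, hK, ?_⟩
  have hm := hΩ.measurableSet.diff hK.measurableSet
  rw [hν, withDensity_apply _ hm, Measure.restrict_restrict hm,
    Set.inter_eq_left.2 Set.sdiff_subset,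
    ← ofReal_integral_eq_lintegral_ofReal (hH.mono_set Set.sdiff_subset) ?_] at hlt
  · exact (ENNReal.ofReal_lt_ofReal_iff hε).1 hlt
  · filter_upwards [ae_restrict_mem hm] with x hx using hH0 x hx.1

/-- Young's inequality with a small parameter, in the form adapted to a weight. -/
lemma exists_mul_rpow_le_add {p r : ℝ} (hp : 1 < p) (hpr : p < r) {s : ℝ} (hs : 0 < s) :
    ∃ C : ℝ, 0 < C ∧ ∀ a W t : ℝ, 0 < W → 0 ≤ t → |a| * t ^ p ≤
      C * (|a| ^ (r / p) * W ^ (-(r / (p * r / (r - p))))) + s * (W * t ^ (p * r / (r - p))) := by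
  have hp0 : 0 < p := by linarith
  have hr0 : 0 < r := by linarith
  have hrp : 0 < r - p := by linarith
  have hconj : (r / p).HolderConjugate (r / (r - p)) := by
    rw [Real.holderConjugate_iff]
    refine ⟨by rwa [lt_div_iff₀ hp0, one_mul], ?_⟩
    field_simp
    ring
  set σ := s ^ ((r - p) / r) with hσ
  have hσ0 : 0 < σ := rpow_pos_of_pos hs _
  have hσs : σ ^ (r / (r - p)) = s := by
    rw [hσ, ← rpow_mul hs.le, show (r - p) / r * (r / (r - p)) = 1 by field_simp, rpow_one]
  refine ⟨(σ ^ (r / p))⁻¹, by positivity, fun a W t hW ht => ?_⟩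
  set θ := (r - p) / r with hθ
  have h := Real.young_inequality_of_nonneg (a := |a| * W ^ (-θ) / σ) (b := σ * (W ^ θ * t ^ p))
    (by positivity) (by positivity) hconj
  have h1 : |a| * W ^ (-θ) / σ * (σ * (W ^ θ * t ^ p)) = |a| * t ^ p := by
    rw [rpow_neg hW.le]
    have : W ^ θ ≠ 0 := by positivity
    field_simp
  rw [h1] at h
  refine h.trans (add_le_add ?_ ?_)
  · refine (div_le_self (by positivity) hconj.lt.le).trans_eq ?_
    rw [div_rpow (by positivity) hσ0.le, mul_rpow (abs_nonneg _) (by positivity), ← rpow_mul hW.le,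
      show -θ * (r / p) = -(r / (p * r / (r - p))) by rw [hθ]; field_simp]
    ring
  · refine (div_le_self (by positivity) hconj.symm.lt.le).trans_eq ?_
    rw [mul_rpow hσ0.le (by positivity), mul_rpow (by positivity) (by positivity), hσs,
      ← rpow_mul hW.le, ← rpow_mul ht, hθ, show (r - p) / r * (r / (r - p)) = 1 by field_simp,
      rpow_one, mul_div_assoc]

lemma tendsto_integral_potential_mul_rpow (hΩ : IsOpen Ω) {r : ℝ} (hp : 1 < p) (hpr : p < r)
    (hWc : ContinuousOn W Ω) (hWpos : ∀ x ∈ Ω, 0 < W x) (hVt : IsLocBddPotential Ω Vt)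
    (hVtInt : IntegrableOn
      (fun x => |Vt x| ^ (r / p) * W x ^ (-(r / (p * r / (r - p))))) Ω)
    {w : ℕ → EuclideanSpace ℝ (Fin d) → ℝ} (hw : ∀ n, IsC1Test Ω (w n))
    (hwW : ∀ n, ∫ x in Ω, W x * |w n x| ^ (p * r / (r - p)) ≤ 1)
    (hwp : ∀ K ⊆ Ω, IsCompact K → Tendsto (fun n => ∫ x in K, |w n x| ^ p) atTop (𝓝 0)) :
    Tendsto (fun n => ∫ x in Ω, Vt x * |w n x| ^ p) atTop (𝓝 0) := by
  have hp0 : 0 < p := by linarith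
  have hrp : 0 < r - p := by linarith
  have hq0 : 0 < p * r / (r - p) := by
    have : 0 < r := by linarith
    positivity
  rw [tendsto_zero_iff_abs_tendsto_zero]
  refine tendsto_zero_of_forall_eventually_le (fun n => abs_nonneg _) fun ε hε => ?_
  obtain ⟨C, hC, hCb⟩ := exists_mul_rpow_le_add hp hpr (s := ε / 3) (by positivity)
  obtain ⟨K, hKΩ, hK, hKlt⟩ := exists_isCompact_setIntegral_sdiff_lt hΩ hVtInt
    (fun x hx => by have := hWpos x hx; positivity) (ε := ε / 3 / C) (by positivity)
  obtain ⟨M, hM0, hM⟩ := hVt.bdd.exists_bound hK hKΩ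
  have hev : ∀ᶠ n in atTop, M * ∫ x in K, |w n x| ^ p < ε / 3 := by
    have := (hwp K hKΩ hK).const_mul M
    rw [mul_zero] at this
    exact this.eventually_lt_const (by positivity)
  filter_upwards [hev] with n hn
  have i0 : IntegrableOn (fun x => |Vt x| * |w n x| ^ p) Ω := by
    refine (hVt.integrableOn hp0 (hw n)).norm.congr (Eventually.of_forall fun x => ?_)
    simp only [norm_mul, Real.norm_eq_abs]
    rw [abs_of_nonneg (by positivity : 0 ≤ |w n x| ^ p)]
  have iW := (hw n).integrableOn_mul_rpow hΩ hWc hq0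
  have iK : ∫ x in K, |Vt x| * |w n x| ^ p ≤ M * ∫ x in K, |w n x| ^ p := by
    rw [← integral_const_mul]
    refine setIntegral_mono_on (i0.mono_set hKΩ)
      (((hw n).integrableOn_rpow hp0).integrableOn.const_mul _) hK.measurableSet fun x hx => ?_
    gcongr
    exact hM x hx
  have i1 : IntegrableOn (fun x => C * (|Vt x| ^ (r / p) * W x ^ (-(r / (p * r / (r - p))))))
    (Ω \ K) := (hVtInt.mono_set Set.sdiff_subset).const_mul _
  have i2 : IntegrableOn (fun x => ε / 3 * (W x * |w n x| ^ (p * r / (r - p)))) (Ω \ K) :=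
    (iW.mono_set Set.sdiff_subset).const_mul _
  have iT : ∫ x in Ω \ K, |Vt x| * |w n x| ^ p ≤ C * (ε / 3 / C) + ε / 3 * 1 := by
    calc _ ≤ ∫ x in Ω \ K, (C * (|Vt x| ^ (r / p) * W x ^ (-(r / (p * r / (r - p)))))
          + ε / 3 * (W x * |w n x| ^ (p * r / (r - p)))) :=
          setIntegral_mono_on (i0.mono_set Set.sdiff_subset) (i1.add i2)
            (hΩ.measurableSet.diff hK.measurableSet)
            fun x hx => hCb _ _ _ (hWpos x hx.1) (abs_nonneg _)
      _ = C * (∫ x in Ω \ K, |Vt x| ^ (r / p) * W x ^ (-(r / (p * r / (r - p))))) +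
          ε / 3 * ∫ x in Ω \ K, W x * |w n x| ^ (p * r / (r - p)) := by
          rw [integral_add i1 i2, integral_const_mul, integral_const_mul]
      _ ≤ _ := by
          gcongr
          refine le_trans (setIntegral_mono_set iW ?_ Set.sdiff_subset.eventuallyLE) (hwW n)
          filter_upwards [ae_restrict_mem hΩ.measurableSet] with x hx
          have := hWpos x hx
          simp only [Pi.zero_apply]
          positivity
  calc |∫ x in Ω, Vt x * |w n x| ^ p| ≤ ∫ x in Ω, |Vt x| * |w n x| ^ p := by
        rw [← Real.norm_eq_abs]
        refine norm_integral_le_of_norm_le i0 (Eventually.of_forall fun x => ?_)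
        rw [norm_mul, Real.norm_eq_abs, Real.norm_of_nonneg (by positivity : 0 ≤ |w n x| ^ p)]
    _ = (∫ x in K, |Vt x| * |w n x| ^ p) + ∫ x in Ω \ K, |Vt x| * |w n x| ^ p := by
        rw [← setIntegral_union Set.disjoint_sdiff_right (hΩ.measurableSet.diff hK.measurableSet)
          (i0.mono_set hKΩ) (i0.mono_set Set.sdiff_subset), Set.union_sdiff_cancel hKΩ]
    _ ≤ ε / 3 + (C * (ε / 3 / C) + ε / 3 * 1) := by linarith
    _ = ε := by field_simp; ring

lemma IsTestFun.const_mul {u : EuclideanSpace ℝ (Fin d) → ℝ} (hu : IsTestFun Ω u) (t : ℝ) :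
    IsTestFun Ω (fun x => t * u x) :=
  ⟨contDiff_const.mul hu.1, hu.2.1.mul_left, tsupport_mul_subset_right.trans hu.2.2⟩

lemma Qpert_const_mul (lam : ℝ) {u : EuclideanSpace ℝ (Fin d) → ℝ} (hu : IsTestFun Ω u) {t : ℝ}
    (ht : 0 < t) : Qpert Ω V Vt p lam (fun x => t * u x) = t ^ p * Qpert Ω V Vt p lam u := by
  have h1 : ∀ x, |t * u x| ^ p = t ^ p * |u x| ^ p := fun x => by
    rw [abs_mul, abs_of_pos ht, mul_rpow ht.le (abs_nonneg _)]
  have h2 : ∀ x, ‖gradient (fun x => t * u x) x‖ ^ p = t ^ p * ‖gradient u x‖ ^ p := fun x => by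
    rw [norm_gradient, norm_gradient, fderiv_const_mul (hu.1.differentiable (by simp) x), norm_smul,
      Real.norm_of_nonneg ht.le, mul_rpow ht.le (norm_nonneg _)]
  rw [Qpert, Qpert, Qfun, Qfun]
  simp only [h1, h2, mul_left_comm _ (t ^ p), ← mul_add, integral_const_mul]

/-- The coercivity bound and the null sequence force both potentials to be measurable. -/
lemma isLocBddPotential_of_isGroundState (hΩ : IsOpen Ω) {q lam : ℝ} (hp : 1 < p) (hpq : p < q)
    (hV : LocBddOn Ω V) (hVt : LocBddOn Ω Vt) (hWc : ContinuousOn W Ω) (hWpos : ∀ x ∈ Ω, 0 < W x)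
    (hQW : ∀ u, IsTestFun Ω u → (∫ x in Ω, W x * |u x| ^ q) ^ (p / q) ≤ Qfun Ω V p u)
    (hgs : IsGroundState Ω p (Qpert Ω V Vt p lam) v) :
    IsLocBddPotential Ω V ∧ IsLocBddPotential Ω Vt := by
  have hp0 : 0 < p := by linarith
  obtain ⟨hv0, hvC, u, ⟨hu, ⟨B, hBo, -, hBc, hBΩ, hB1⟩, hlim⟩, hconv⟩ := hgs
  obtain ⟨c, hc, hcN⟩ := exists_pos_le_weighted_integral hΩ hp hpq hWc hWpos hBo hBc hBΩ
  have hq0 : 0 < q := by linarith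
  have hcp : 0 < c ^ (p / q) := by positivity
  have hQc : ∀ k, c ^ (p / q) ≤ Qfun Ω V p (u k) := fun k =>
    (rpow_le_rpow hc.le (hcN _ (hu k).1 (hu k).2 (hB1 k)) (by positivity)).trans (hQW _ (hu k).1)
  have hu1 := fun k => (hu k).1.isC1Test
  have huc := fun k => (hu1 k).contDiff.continuous
  refine ⟨⟨hV, ?_⟩, ⟨hVt, ?_⟩⟩
  · refine aestronglyMeasurable_of_mul_approx hΩ hp0 hvC.continuousOn hv0 huc hconv
      (Eventually.of_forall fun k => ?_)
    have hi : IntegrableOn (fun x => ‖gradient (u k) x‖ ^ p + V x * |u k x| ^ p) Ω := by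
      by_contra hi
      have := hQc k
      rw [Qfun, integral_undef hi, mul_zero] at this
      linarith
    have := (hi.sub ((hu1 k).integrable_gradient_rpow hp0).integrableOn).aestronglyMeasurable
    refine this.congr (Eventually.of_forall fun x => ?_)
    simp
  · refine aestronglyMeasurable_of_mul_approx hΩ hp0 hvC.continuousOn hv0 huc hconv ?_
    filter_upwards [hlim.eventually_lt_const hcp] with k hk
    by_contra hi
    have hi' : ¬ IntegrableOn (fun x => Vt x * |u k x| ^ p) Ω := fun h => hi h.aestronglyMeasurable
    rw [Qpert, integral_undef hi', mul_zero, add_zero] at hk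
    linarith [hQc k]

lemma IsGroundState.isEnergyGroundState (hΩ : IsOpen Ω) {lam : ℝ} (hp : 0 < p)
    (hV : IsLocBddPotential Ω V) (hVt : IsLocBddPotential Ω Vt)
    (hnonneg : ∀ u, IsTestFun Ω u → 0 ≤ Qpert Ω V Vt p lam u)
    (hgs : IsGroundState Ω p (Qpert Ω V Vt p lam) v) :
    IsEnergyGroundState Ω (fun x => V x + p * lam * Vt x) p v := by
  have hU := hV.add_const_mul hVt (p * lam)
  obtain ⟨hv0, hvC, u, ⟨hu, -, hlim⟩, hconv⟩ := hgs
  refine ⟨hU, fun w hw => energy_nonneg_of_isC1Test hΩ hp hU (fun u hu => ?_) hw, hv0, hvC, u,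
    fun n => (hu n).1.isC1Test, ?_, hconv⟩
  · rw [← Qpert_eq_energy hp hV hVt lam hu.isC1Test]
    exact mul_nonneg hp.le (hnonneg u hu)
  · have := hlim.const_mul p
    rw [mul_zero] at this
    exact this.congr fun n => Qpert_eq_energy hp hV hVt lam (hu n).1.isC1Test

end Critical

/-- Hardy–Sobolev–Maz'ya–Poincaré inequality in the critical case. -/
theorem hsm_poincare_critical {d : ℕ}
    (Ω : Set (EuclideanSpace ℝ (Fin d))) (hΩo : IsOpen Ω) (hΩc : IsConnected Ω)
    (p : ℝ) (hp : 1 < p) (hdp : p < (d : ℝ))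
    (V : EuclideanSpace ℝ (Fin d) → ℝ) (hV : LocBddOn Ω V)
    (pstar : ℝ) (hpstar : pstar = p * d / ((d : ℝ) - p))
    (W : EuclideanSpace ℝ (Fin d) → ℝ)
    (hWc : ContinuousOn W Ω) (hWpos : ∀ x ∈ Ω, 0 < W x)
    (hQW : ∀ u, IsTestFun Ω u →
      (∫ x in Ω, W x * |u x| ^ pstar) ^ (p / pstar) ≤ Qfun Ω V p u)
    (Vt : EuclideanSpace ℝ (Fin d) → ℝ) (hVt : LocBddOn Ω Vt)
    (hVtInt : IntegrableOn
      (fun x => |Vt x| ^ ((d : ℝ) / p) * W x ^ (-((d : ℝ) / pstar))) Ω volume)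
    (lam : ℝ)
    (hlamNonneg : ∀ u, IsTestFun Ω u → 0 ≤ Qpert Ω V Vt p lam u)
    (v : EuclideanSpace ℝ (Fin d) → ℝ)
    (hgs : IsGroundState Ω p (Qpert Ω V Vt p lam) v) :
    ∀ ψ, IsTestFun Ω ψ → (∫ x in Ω, ψ x * v x) ≠ 0 →
      ∃ C C₁ : ℝ, 0 < C ∧ 0 < C₁ ∧
        ∀ u, IsTestFun Ω u →
          C * (∫ x in Ω, W x * |u x| ^ pstar) ^ (p / pstar) ≤
            Qpert Ω V Vt p lam u + C₁ * |∫ x in Ω, ψ x * u x| ^ p := by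
  intro ψ hψ hψv
  have hp0 : 0 < p := by linarith
  have hdp0 : 0 < (d : ℝ) - p := by linarith
  have hpq : p < pstar := by
    rw [hpstar, lt_div_iff₀ hdp0]
    nlinarith
  have hq0 : 0 < pstar := by linarith
  obtain ⟨hVp, hVtp⟩ := isLocBddPotential_of_isGroundState hΩo hp hpq hV hVt hWc hWpos hQW hgs
  have hE := hgs.isEnergyGroundState hΩo hp0 hVp hVtp hlamNonneg
  by_contra! hcon
  have hseq : ∀ n : ℕ, ∃ w, IsTestFun Ω w ∧ (∫ x in Ω, W x * |w x| ^ pstar) = 1 ∧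
      Qpert Ω V Vt p lam w + |∫ x in Ω, ψ x * w x| ^ p ≤ 1 / ((n : ℝ) + 1) := by
    intro n
    obtain ⟨u, hu, hlt⟩ := hcon (1 / ((n : ℝ) + 1)) 1 (by positivity) one_pos
    set N := ∫ x in Ω, W x * |u x| ^ pstar with hN
    have hN0 : 0 ≤ N := setIntegral_nonneg hΩo.measurableSet fun x hx => by
      have := hWpos x hx
      positivity
    have hNpos : 0 < N := by
      refine hN0.lt_of_ne fun h => ?_
      rw [← h, zero_rpow (by positivity), mul_zero] at hlt
      have := hlamNonneg u hu
      have : 0 ≤ |∫ x in Ω, ψ x * u x| ^ p := by positivity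
      linarith
    set t := N ^ (-(1 / pstar)) with ht
    have ht0 : 0 < t := by positivity
    have htq : t ^ pstar = N⁻¹ := by
      rw [ht, ← rpow_mul hN0, show -(1 / pstar) * pstar = -1 by field_simp, rpow_neg_one]
    have htp : t ^ p = (N ^ (p / pstar))⁻¹ := by
      rw [ht, ← rpow_mul hN0, ← rpow_neg hN0]
      congr 1
      ring
    refine ⟨fun x => t * u x, hu.const_mul t, ?_, ?_⟩
    · simp only [abs_mul, abs_of_pos ht0, mul_rpow ht0.le (abs_nonneg _), mul_left_comm (W _)]
      rw [integral_const_mul, htq, inv_mul_cancel₀ hNpos.ne']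
    · rw [Qpert_const_mul lam hu ht0]
      simp only [mul_left_comm (ψ _)]
      rw [integral_const_mul, abs_mul, abs_of_pos ht0, mul_rpow ht0.le (abs_nonneg _), ← mul_add,
        htp, inv_mul_le_iff₀ (by positivity)]
      linarith
  choose w hw hw1 hwQ using hseq
  have hwC := fun n => (hw n).isC1Test
  have hQ0 : Tendsto (fun n => Qpert Ω V Vt p lam (w n)) atTop (𝓝 0) :=
    squeeze_zero (fun n => hlamNonneg _ (hw n))
      (fun n => (le_add_of_nonneg_right (by positivity)).trans (hwQ n))
      tendsto_one_div_add_atTop_nhds_zero_nat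
  have hψ0 : Tendsto (fun n => ∫ x in Ω, ψ x * w n x) atTop (𝓝 0) := by
    have h1 : Tendsto (fun n => |∫ x in Ω, ψ x * w n x| ^ p) atTop (𝓝 0) :=
      squeeze_zero (fun n => by positivity)
        (fun n => (le_add_of_nonneg_left (hlamNonneg _ (hw n))).trans (hwQ n))
        tendsto_one_div_add_atTop_nhds_zero_nat
    have h2 := h1.rpow_const (p := p⁻¹) (Or.inr (by positivity))
    rw [zero_rpow (by positivity)] at h2
    rw [tendsto_zero_iff_abs_tendsto_zero]
    refine h2.congr fun n => ?_
    rw [Function.comp_apply, rpow_rpow_inv (abs_nonneg _) hp0.ne']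
  have hE0 : Tendsto (fun n => energy Ω (fun x => V x + p * lam * Vt x) p (w n)) atTop (𝓝 0) := by
    have := hQ0.const_mul p
    rw [mul_zero] at this
    exact this.congr fun n => Qpert_eq_energy hp0 hVp hVtp lam (hwC n)
  have hloc : ∀ K ⊆ Ω, IsCompact K → Tendsto (fun n => ∫ x in K, |w n x| ^ p) atTop (𝓝 0) := by
    intro K hKΩ hK
    refine tendsto_integral_rpow_of_tendsto_integral_abs hΩo hp hpq hWc hWpos hwC
      (fun n => (hw1 n).le) hKΩ hK ?_
    refine hE.tendsto_integral_abs hΩo hΩc hp hwC hE0 (fun K hKΩ hK => ?_) hψ.isC1Test hψv hψ0 hKΩ hK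
    obtain ⟨M, hM⟩ := exists_integral_rpow_le hΩo hp0 hpq hWc hWpos hKΩ hK
    exact ⟨M, fun n => hM _ (hwC n) (hw1 n).le⟩
  have hVt0 : Tendsto (fun n => ∫ x in Ω, Vt x * |w n x| ^ p) atTop (𝓝 0) := by
    subst hpstar
    exact tendsto_integral_potential_mul_rpow hΩo hp hdp hWc hWpos hVtp hVtInt hwC
      (fun n => (hw1 n).le) hloc
  have hlim : Tendsto (fun n => Qfun Ω V p (w n)) atTop (𝓝 0) := by
    have := hQ0.sub (hVt0.const_mul lam)
    rw [mul_zero, sub_zero] at this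
    refine this.congr fun n => ?_
    rw [Qpert, add_sub_cancel_right]
  have h1 : ∀ n, 1 ≤ Qfun Ω V p (w n) := fun n => by
    have := hQW _ (hw n)
    rwa [hw1 n, one_rpow] at this
  linarith [ge_of_tendsto' hlim h1]
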